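/- arXiv:2206.03747 — 7 statements merged into one kernel-verified Lean document; each statement's English description precedes it below -/
import Mathlib

section
/- Let a, b > 0, let t ∈ ℝ and let M = (a·cos t, b·sin t) be a point of the ellipse E(a,b). Then for all points N, L on E(a,b) such that M, N, L are pairwise distinct and the unsigned angle ∠NML equals π/2, the fixed point F = ((a²−b²)/(a²+b²))·(a·cos t, −b·sin t) lies on the line through N and L (the Frégier point of M). -/
open EuclideanGeometry

noncomputable section

/-- Points of the Euclidean plane. -/
abbrev Pt := EuclideanSpace ℝ (Fin 2)

/-- The ellipse with semi-axes `a`, `b`, centered at the origin. -/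
def ellipseE (a b : ℝ) : Set Pt := {p | p 0 ^ 2 / a ^ 2 + p 1 ^ 2 / b ^ 2 = 1}

/-- The line (affine span) through two points. -/
def lineThrough (P Q : Pt) : Set Pt := (affineSpan ℝ {P, Q} : Set Pt)

/-- The equation satisfied by a chord vector `(x, y)` of the ellipse starting at its point `(p, q)`. -/
theorem ellipse_chord_eq {a b p q x y : ℝ} (ha : 0 < a) (hb : 0 < b)
    (hM : p ^ 2 / a ^ 2 + q ^ 2 / b ^ 2 = 1)
    (hN : (p + x) ^ 2 / a ^ 2 + (q + y) ^ 2 / b ^ 2 = 1) :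
    b ^ 2 * x ^ 2 + a ^ 2 * y ^ 2 = -2 * (b ^ 2 * p * x + a ^ 2 * q * y) := by
  field_simp at hM hN
  linear_combination hN - hM

/-- Two orthogonal vectors of the plane, the first nonzero, differ by a quarter turn and a scalar. -/
theorem exists_quarter_turn_of_orthogonal {x y z w : ℝ} (h : 0 < x ^ 2 + y ^ 2)
    (hort : x * z + y * w = 0) : ∃ k : ℝ, z = -(k * y) ∧ w = k * x := by
  refine ⟨(x * w - y * z) / (x ^ 2 + y ^ 2), ?_, ?_⟩
  · field_simp
    linear_combination x * hort
  · field_simp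
    linear_combination y * hort

theorem sq_add_sq_pos_of_ne {M N : Pt} (h : M ≠ N) :
    0 < (N 0 - M 0) ^ 2 + (N 1 - M 1) ^ 2 := by
  by_contra! hle
  refine h ?_
  ext i
  fin_cases i
  · show M 0 = N 0
    nlinarith [sq_nonneg (N 0 - M 0), sq_nonneg (N 1 - M 1)]
  · show M 1 = N 1
    nlinarith [sq_nonneg (N 0 - M 0), sq_nonneg (N 1 - M 1)]

/-- **Frégier point.** For `M = (a cos t, b sin t)` on the ellipse, every chord `NL`
subtending a right angle at `M` passes through the fixed point
`F = ((a²−b²)/(a²+b²)) • (a cos t, −b sin t)`. -/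
theorem fregier_point (a b t : ℝ) (ha : 0 < a) (hb : 0 < b)
    (M F : Pt)
    (hM0 : M 0 = a * Real.cos t) (hM1 : M 1 = b * Real.sin t)
    (hF0 : F 0 = (a ^ 2 - b ^ 2) / (a ^ 2 + b ^ 2) * (a * Real.cos t))
    (hF1 : F 1 = (a ^ 2 - b ^ 2) / (a ^ 2 + b ^ 2) * (-(b * Real.sin t))) :
    ∀ N L : Pt, N ∈ ellipseE a b → L ∈ ellipseE a b →
      M ≠ N → M ≠ L → N ≠ L →
      EuclideanGeometry.angle N M L = Real.pi / 2 →
      F ∈ lineThrough N L := by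
  intro N L hN hL hMN hML _ hang
  have hMe : M 0 ^ 2 / a ^ 2 + M 1 ^ 2 / b ^ 2 = 1 := by
    rw [hM0, hM1]
    field_simp
    exact Real.cos_sq_add_sin_sq t
  have hu := sq_add_sq_pos_of_ne hMN
  have hv := sq_add_sq_pos_of_ne hML
  have hort : (N 0 - M 0) * (L 0 - M 0) + (N 1 - M 1) * (L 1 - M 1) = 0 := by
    have h := InnerProductGeometry.inner_eq_zero_iff_angle_eq_pi_div_two _ _ |>.mpr hang
    simp [PiLp.inner_apply, Fin.sum_univ_two] at h
    linear_combination h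
  have hN' := ellipse_chord_eq (x := N 0 - M 0) (y := N 1 - M 1) ha hb hMe
    (by simpa [ellipseE] using hN)
  have hL' := ellipse_chord_eq (x := L 0 - M 0) (y := L 1 - M 1) ha hb hMe
    (by simpa [ellipseE] using hL)
  obtain ⟨k, hk0, hk1⟩ := exists_quarter_turn_of_orthogonal hu hort
  rw [← hM0] at hF0
  rw [← hM1] at hF1
  set x := N 0 - M 0 with hx
  set y := N 1 - M 1 with hy
  rw [hk0, hk1] at hL' hv
  have hk : k ≠ 0 := by
    rintro rfl
    simp at hv
  have hkB : k * (b ^ 2 * y ^ 2 + a ^ 2 * x ^ 2)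
      = -2 * (-(b ^ 2 * M 0 * y) + a ^ 2 * M 1 * x) := by
    apply mul_left_cancel₀ hk
    linear_combination hL'
  have hS : 0 < a ^ 2 + b ^ 2 := by positivity
  have hF : F = AffineMap.lineMap N L
      ((b ^ 2 * y ^ 2 + a ^ 2 * x ^ 2) / ((a ^ 2 + b ^ 2) * (x ^ 2 + y ^ 2))) := by
    have hN0 : N 0 = M 0 + x := by rw [hx]; ring
    have hN1 : N 1 = M 1 + y := by rw [hy]; ring
    have hL0 : L 0 = M 0 - k * y := by linear_combination hk0
    have hL1 : L 1 = M 1 + k * x := by linear_combination hk1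
    clear_value x y
    ext i
    fin_cases i
    · simp only [AffineMap.lineMap_apply, vsub_eq_sub, vadd_eq_add, PiLp.add_apply,
        PiLp.smul_apply, PiLp.sub_apply, smul_eq_mul, Fin.zero_eta, hF0, hN0, hL0]
      field_simp
      linear_combination y * hkB - x * hN'
    · simp only [AffineMap.lineMap_apply, vsub_eq_sub, vadd_eq_add, PiLp.add_apply,
        PiLp.smul_apply, PiLp.sub_apply, smul_eq_mul, Fin.mk_one, hF1, hN1, hL1]
      field_simp
      linear_combination -x * hkB - y * hN'
  rw [hF]
  exact AffineMap.lineMap_mem_affineSpan_pair _ N L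
end
end

section
/- Let a, b > 0, let M be a point of the ellipse E(a,b), and let θ ∈ (0,π) with cos θ ≠ 0. Then there exist a point c ∈ ℝ² and a symmetric positive-definite 2×2 real matrix Q such that for all points N, L on E(a,b) with M, N, L pairwise distinct and ∠NML = θ, the line through N and L is tangent to the ellipse E(c,Q); that is, the envelope of the chords subtending angle θ at M is contained in an ellipse. -/
open EuclideanGeometry

noncomputable section

/-- The ellipse `{p : (p−c)ᵀ Q (p−c) = 1}` with center `c` and positive-definite
symmetric matrix `Q`. -/
def ellipseQ (c : Pt) (Q : Matrix (Fin 2) (Fin 2) ℝ) : Set Pt :=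
  {p | ∑ i, ∑ j, (p i - c i) * Q i j * (p j - c j) = 1}

/-- A line is tangent to a set if they meet in exactly one point. -/
def IsTangentTo (l S : Set Pt) : Prop := ∃! p, p ∈ l ∩ S

/-- `l` is a line of the plane (the affine span of two distinct points). -/
def IsLine (l : Set Pt) : Prop := ∃ P Q : Pt, P ≠ Q ∧ l = lineThrough P Q

open Matrix in
/-- Sylvester's criterion for a real symmetric `2 × 2` matrix. -/
theorem posDef_fin_two {α β γ : ℝ} (hα : 0 < α) (hdet : 0 < α * γ - β ^ 2) :
    (!![α, β; β, γ] : Matrix (Fin 2) (Fin 2) ℝ).PosDef := by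
  refine PosDef.of_dotProduct_mulVec_pos ?_ fun x hx => ?_
  · ext i j
    fin_cases i <;> fin_cases j <;> simp
  · have hexp : star x ⬝ᵥ (!![α, β; β, γ] *ᵥ x) =
        α * x 0 ^ 2 + 2 * β * (x 0 * x 1) + γ * x 1 ^ 2 := by
      simp [dotProduct, mulVec, Fin.sum_univ_two]
      ring
    rw [hexp]
    have hsq : α * (α * x 0 ^ 2 + 2 * β * (x 0 * x 1) + γ * x 1 ^ 2) =
        (α * x 0 + β * x 1) ^ 2 + (α * γ - β ^ 2) * x 1 ^ 2 := by ring
    refine pos_of_mul_pos_right (a := α) ?_ hα.le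
    rw [hsq]
    by_cases h1 : x 1 = 0
    · have h0 : x 0 ≠ 0 := fun h0 => hx (by ext i; fin_cases i <;> simp [h0, h1])
      rw [h1]
      have : 0 < (α * x 0) ^ 2 := by positivity
      simpa using this
    · have : 0 < (α * γ - β ^ 2) * x 1 ^ 2 := by positivity
      positivity

/-- A criterion for the line through two points to be tangent to an ellipse. -/
theorem isTangentTo_ellipseQ {α β γ : ℝ} (hα : 0 < α) (hdet : 0 < α * γ - β ^ 2)
    {c N L : Pt} (hNL : N ≠ L)
    (h : α * (L 0 - N 0) ^ 2 + 2 * β * ((L 0 - N 0) * (L 1 - N 1)) + γ * (L 1 - N 1) ^ 2 =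
      (α * γ - β ^ 2) * ((N 0 - c 0) * (L 1 - c 1) - (N 1 - c 1) * (L 0 - c 0)) ^ 2) :
    IsTangentTo (lineThrough N L) (ellipseQ c !![α, β; β, γ]) := by
  set A := α * (L 0 - N 0) ^ 2 + 2 * β * ((L 0 - N 0) * (L 1 - N 1)) + γ * (L 1 - N 1) ^ 2
    with hA
  set B := (N 0 - c 0) * (α * (L 0 - N 0) + β * (L 1 - N 1)) +
    (N 1 - c 1) * (β * (L 0 - N 0) + γ * (L 1 - N 1)) with hB
  have hA0 : A ≠ 0 := by
    intro h0
    have hsq : (α * (L 0 - N 0) + β * (L 1 - N 1)) ^ 2 +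
        (α * γ - β ^ 2) * (L 1 - N 1) ^ 2 = 0 := by
      linear_combination α * h0
    have h1 : L 1 - N 1 = 0 := by
      by_contra h1
      have : 0 < (α * γ - β ^ 2) * (L 1 - N 1) ^ 2 := by positivity
      nlinarith [sq_nonneg (α * (L 0 - N 0) + β * (L 1 - N 1))]
    rw [h1] at hsq
    have h2 : L 0 - N 0 = 0 := by simpa [hα.ne'] using hsq
    exact hNL (by ext i; fin_cases i <;> simp <;> linarith)
  have hmem : ∀ t : ℝ, AffineMap.lineMap N L t ∈ ellipseQ c !![α, β; β, γ] ↔ A * t + B = 0 := by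
    intro t
    have hq : A * ((∑ i, ∑ j, ((AffineMap.lineMap N L t : Pt) i - c i) * !![α, β; β, γ] i j *
        ((AffineMap.lineMap N L t : Pt) j - c j)) - 1) = (A * t + B) ^ 2 := by
      simp only [Fin.sum_univ_two, AffineMap.lineMap_apply, vsub_eq_sub, vadd_eq_add,
        PiLp.add_apply, PiLp.smul_apply, PiLp.sub_apply, smul_eq_mul, Matrix.of_apply,
        Matrix.cons_val_zero, Matrix.cons_val_one, Matrix.cons_val', Matrix.cons_val_fin_one]
      have h' := h
      rw [hA] at h' ⊢
      rw [hB]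
      linear_combination -h'
    change (∑ i, ∑ j, ((AffineMap.lineMap N L t : Pt) i - c i) * !![α, β; β, γ] i j *
        ((AffineMap.lineMap N L t : Pt) j - c j)) = 1 ↔ _
    rw [← sub_eq_zero, ← pow_eq_zero_iff (a := A * t + B) two_ne_zero, ← hq, mul_eq_zero,
      or_iff_right hA0]
  refine ⟨AffineMap.lineMap N L (-B / A),
    ⟨AffineMap.lineMap_mem_affineSpan_pair _ _ _, (hmem _).2 (by field_simp; ring)⟩, ?_⟩
  rintro p ⟨hp, hpE⟩
  obtain ⟨t, rfl⟩ := mem_affineSpan_pair_iff_exists_lineMap_eq.1 hp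
  have ht := (hmem t).1 hpE
  congr 1
  field_simp
  linarith

/-- The relation between the dot and cross products of the two sides of an angle `θ`. -/
theorem dot_sq_mul_sin_sq_of_angle_eq {M N L : Pt} {θ : ℝ}
    (h : EuclideanGeometry.angle N M L = θ) :
    ((N 0 - M 0) * (L 0 - M 0) + (N 1 - M 1) * (L 1 - M 1)) ^ 2 * Real.sin θ ^ 2 =
      Real.cos θ ^ 2 * ((N 0 - M 0) * (L 1 - M 1) - (N 1 - M 1) * (L 0 - M 0)) ^ 2 := by
  have hc := InnerProductGeometry.cos_angle_mul_norm_mul_norm (N - M) (L - M)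
  have hang : InnerProductGeometry.angle (N - M) (L - M) = θ := h
  have hN := EuclideanSpace.real_norm_sq_eq (N - M)
  have hL := EuclideanSpace.real_norm_sq_eq (L - M)
  rw [hang] at hc
  simp only [PiLp.inner_apply, Fin.sum_univ_two, PiLp.sub_apply, RCLike.inner_apply,
    conj_trivial] at hc hN hL
  have hc2 : Real.cos θ ^ 2 * (‖N - M‖ ^ 2 * ‖L - M‖ ^ 2) =
      ((N 0 - M 0) * (L 0 - M 0) + (N 1 - M 1) * (L 1 - M 1)) ^ 2 := by
    rw [← mul_pow, ← mul_pow, hc]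
    ring
  rw [hN, hL] at hc2
  rw [Real.sin_sq]
  linear_combination -hc2

theorem eq_of_sub_sq_add_sub_sq_eq_zero {P Q : Pt}
    (h : (Q 0 - P 0) ^ 2 + (Q 1 - P 1) ^ 2 = 0) : P = Q := by
  have h0 : (Q 0 - P 0) ^ 2 = 0 := by nlinarith [sq_nonneg (Q 0 - P 0), sq_nonneg (Q 1 - P 1)]
  have h1 : (Q 1 - P 1) ^ 2 = 0 := by linarith
  rw [sq_eq_zero_iff, sub_eq_zero] at h0 h1
  ext i
  fin_cases i
  exacts [h0.symm, h1.symm]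

theorem cross_ne_zero_of_angle_eq {M N L : Pt} {θ : ℝ} (hN : M ≠ N) (hL : M ≠ L)
    (hsin : Real.sin θ ≠ 0) (h : EuclideanGeometry.angle N M L = θ) :
    (N 0 - M 0) * (L 1 - M 1) - (N 1 - M 1) * (L 0 - M 0) ≠ 0 := by
  intro h0
  apply hsin
  have hS := dot_sq_mul_sin_sq_of_angle_eq h
  rw [h0] at hS
  by_contra hs
  have hd : (N 0 - M 0) * (L 0 - M 0) + (N 1 - M 1) * (L 1 - M 1) = 0 := by simpa [hs] using hS
  have hNL : ((N 0 - M 0) ^ 2 + (N 1 - M 1) ^ 2) * ((L 0 - M 0) ^ 2 + (L 1 - M 1) ^ 2) = 0 := by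
    linear_combination ((N 0 - M 0) * (L 0 - M 0) + (N 1 - M 1) * (L 1 - M 1)) * hd +
      ((N 0 - M 0) * (L 1 - M 1) - (N 1 - M 1) * (L 0 - M 0)) * h0
  rcases mul_eq_zero.1 hNL with h1 | h1
  · exact hN (eq_of_sub_sq_add_sub_sq_eq_zero h1)
  · exact hL (eq_of_sub_sq_add_sub_sq_eq_zero h1)

theorem two_mul_mul_one_sub_dot_eq_cross_mul {m₀ m₁ n₀ n₁ l₀ l₁ : ℝ} (hm : m₀ ^ 2 + m₁ ^ 2 = 1)
    (hn : n₀ ^ 2 + n₁ ^ 2 = 1) (hl : l₀ ^ 2 + l₁ ^ 2 = 1) :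
    2 * ((n₀ - m₀) * (l₀ - m₀)) * (1 - (n₀ * l₀ + n₁ * l₁)) =
      ((n₀ - m₀) * (l₁ - m₁) - (n₁ - m₁) * (l₀ - m₀)) *
        (m₀ * (n₁ - l₁) - m₁ * (l₀ - n₀) + (n₀ * l₁ - n₁ * l₀)) := by
  grind

/-- The dual conic of the envelope, in coordinates where the given ellipse is the unit circle. -/
theorem chord_dual_conic {a b s c m₀ m₁ n₀ n₁ l₀ l₁ : ℝ} (ha : 0 < a) (hb : 0 < b)
    (hm : m₀ ^ 2 + m₁ ^ 2 = 1) (hn : n₀ ^ 2 + n₁ ^ 2 = 1) (hl : l₀ ^ 2 + l₁ ^ 2 = 1)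
    (hcross : (n₀ - m₀) * (l₁ - m₁) - (n₁ - m₁) * (l₀ - m₀) ≠ 0)
    (h : (a ^ 2 * ((n₀ - m₀) * (l₀ - m₀)) + b ^ 2 * ((n₁ - m₁) * (l₁ - m₁))) ^ 2 * s ^ 2 =
      c ^ 2 * (a * b * ((n₀ - m₀) * (l₁ - m₁) - (n₁ - m₁) * (l₀ - m₀))) ^ 2) :
    4 * a ^ 2 * b ^ 2 * c ^ 2 * (1 - (n₀ * l₀ + n₁ * l₁)) ^ 2 =
      s ^ 2 * (a ^ 2 + b ^ 2) ^ 2 *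
        ((a ^ 2 - b ^ 2) / (a ^ 2 + b ^ 2) * (m₀ * (n₁ - l₁) - m₁ * (l₀ - n₀)) +
          (n₀ * l₁ - n₁ * l₀)) ^ 2 := by
  have h0 := two_mul_mul_one_sub_dot_eq_cross_mul hm hn hl
  have h1 := two_mul_mul_one_sub_dot_eq_cross_mul (m₀ := m₁) (m₁ := m₀) (n₀ := n₁) (n₁ := n₀)
    (l₀ := l₁) (l₁ := l₀) (by linarith) (by linarith) (by linarith)
  have hab : a ^ 2 + b ^ 2 ≠ 0 := by positivity
  rw [mul_assoc (s ^ 2), ← mul_pow, mul_add, ← mul_assoc (a ^ 2 + b ^ 2), mul_div_cancel₀ _ hab]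
  set K := (n₀ - m₀) * (l₁ - m₁) - (n₁ - m₁) * (l₀ - m₀) with hK
  set d := 1 - (n₀ * l₀ + n₁ * l₁) with hd
  set P := (a ^ 2 - b ^ 2) * (m₀ * (n₁ - l₁) - m₁ * (l₀ - n₀)) +
    (a ^ 2 + b ^ 2) * (n₀ * l₁ - n₁ * l₀) with hP
  set D := a ^ 2 * ((n₀ - m₀) * (l₀ - m₀)) + b ^ 2 * ((n₁ - m₁) * (l₁ - m₁)) with hD
  have hlin : 2 * D * d = K * P := by
    rw [hD, hd, hP]
    linear_combination a ^ 2 * h0 + b ^ 2 * h1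
  refine mul_left_cancel₀ (pow_ne_zero 2 hcross) ?_
  linear_combination s ^ 2 * (2 * D * d + K * P) * hlin - 4 * d ^ 2 * h

/-- Passage from the dual conic `T (1 - n·l)² = S (κ π₀ + w)²` to the tangency criterion. -/
theorem tangency_of_chord_dual_conic {S T κ r m₀ m₁ n₀ n₁ l₀ l₁ : ℝ}
    (hS : 0 < S) (hT : 0 < T) (hr : r = S / (S + T)) (hn : n₀ ^ 2 + n₁ ^ 2 = 1)
    (h : T * (1 - (n₀ * l₀ + n₁ * l₁)) ^ 2 =
      S * (κ * (m₀ * (n₁ - l₁) - m₁ * (l₀ - n₀)) + (n₀ * l₁ - n₁ * l₀)) ^ 2) :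
    (1 - r) * ((n₁ - l₁) ^ 2 + (l₀ - n₀) ^ 2 -
        r * κ ^ 2 * (m₀ * (n₁ - l₁) - m₁ * (l₀ - n₀)) ^ 2) =
      (r * κ * (m₀ * (n₁ - l₁) - m₁ * (l₀ - n₀)) + (n₀ * l₁ - n₁ * l₀)) ^ 2 := by
  have hST : S + T ≠ 0 := by positivity
  have hchord : (n₁ - l₁) ^ 2 + (l₀ - n₀) ^ 2 =
      (1 - (n₀ * l₀ + n₁ * l₁)) ^ 2 + (n₀ * l₁ - n₁ * l₀) ^ 2 := by grind
  have hr' : (1 - r) * (1 - (n₀ * l₀ + n₁ * l₁)) ^ 2 =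
      r * (κ * (m₀ * (n₁ - l₁) - m₁ * (l₀ - n₀)) + (n₀ * l₁ - n₁ * l₀)) ^ 2 := by
    rw [hr]
    field_simp
    linear_combination h
  rw [hchord]
  linear_combination hr'

/-- **Frégier ellipse exists.** The chords of the ellipse subtending a fixed angle `θ`
(with `cos θ ≠ 0`) at a fixed point `M` of the ellipse all are tangent to one ellipse. -/
theorem fregier_ellipse_exists (a b θ : ℝ) (ha : 0 < a) (hb : 0 < b)
    (M : Pt) (hM : M ∈ ellipseE a b)
    (hθ : θ ∈ Set.Ioo 0 Real.pi) (hcos : Real.cos θ ≠ 0) :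
    ∃ (c : Pt) (Q : Matrix (Fin 2) (Fin 2) ℝ), Q.IsSymm ∧ Q.PosDef ∧
      ∀ N L : Pt, N ∈ ellipseE a b → L ∈ ellipseE a b →
        M ≠ N → M ≠ L → N ≠ L →
        EuclideanGeometry.angle N M L = θ →
        IsTangentTo (lineThrough N L) (ellipseQ c Q) := by
  have hM' : (M 0 / a) ^ 2 + (M 1 / b) ^ 2 = 1 := by rw [div_pow, div_pow]; exact hM
  have hsin : 0 < Real.sin θ := Real.sin_pos_of_mem_Ioo hθ
  set S := Real.sin θ ^ 2 * (a ^ 2 + b ^ 2) ^ 2 with hS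
  set T := 4 * a ^ 2 * b ^ 2 * Real.cos θ ^ 2 with hT
  set κ := (a ^ 2 - b ^ 2) / (a ^ 2 + b ^ 2) with hκ
  obtain ⟨r, hr⟩ : ∃ r, r = S / (S + T) := ⟨_, rfl⟩
  obtain ⟨m₀, hm₀⟩ : ∃ m₀, m₀ = M 0 / a := ⟨_, rfl⟩
  obtain ⟨m₁, hm₁⟩ : ∃ m₁, m₁ = M 1 / b := ⟨_, rfl⟩
  rw [← hm₀, ← hm₁] at hM'
  have hSpos : 0 < S := by positivity
  have hTpos : 0 < T := by positivity
  have hr0 : 0 < r := by rw [hr]; positivity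
  have hr1 : 0 < 1 - r := by
    rw [hr, sub_pos, div_lt_one (by positivity)]
    linarith
  have hκ1 : κ ^ 2 ≤ 1 := by
    rw [hκ, div_pow, div_le_one (by positivity)]
    nlinarith [mul_pos (pow_pos ha 2) (pow_pos hb 2)]
  have hrκ : 0 < 1 - r * κ ^ 2 := by nlinarith
  have hrm : 0 < 1 - r * κ ^ 2 * m₁ ^ 2 := by
    nlinarith [mul_nonneg (mul_nonneg hr0.le (sq_nonneg κ)) (sq_nonneg m₀)]
  set e := (1 - r) * (1 - r * κ ^ 2) with he
  have hepos : 0 < e := by positivity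
  set α := (1 - r * κ ^ 2 * m₁ ^ 2) / (a ^ 2 * e) with hα
  set β := -(r * κ ^ 2 * m₀ * m₁) / (a * b * e) with hβ
  set γ := (1 - r * κ ^ 2 * m₀ ^ 2) / (b ^ 2 * e) with hγ
  have hαpos : 0 < α := by positivity
  have hdet : α * γ - β ^ 2 = 1 / (a ^ 2 * b ^ 2 * ((1 - r) * e)) := by
    rw [hα, hβ, hγ]
    field_simp
    rw [he]
    linear_combination -(1 - r) * r * κ ^ 2 * hM'
  have hdetpos : 0 < α * γ - β ^ 2 := by rw [hdet]; positivity
  refine ⟨!₂[r * κ * a * m₀, -(r * κ * b * m₁)], !![α, β; β, γ], ?_,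
    posDef_fin_two hαpos hdetpos, ?_⟩
  · ext i j
    fin_cases i <;> fin_cases j <;> rfl
  intro N L hN hL hMN hML hNL hang
  refine isTangentTo_ellipseQ hαpos hdetpos hNL ?_
  have hN' : (N 0 / a) ^ 2 + (N 1 / b) ^ 2 = 1 := by rw [div_pow, div_pow]; exact hN
  have hL' : (L 0 / a) ^ 2 + (L 1 / b) ^ 2 = 1 := by rw [div_pow, div_pow]; exact hL
  have hcross := cross_ne_zero_of_angle_eq hMN hML hsin.ne' hang
  have hdot := dot_sq_mul_sin_sq_of_angle_eq hang
  have hM0 : M 0 = a * m₀ := by rw [hm₀]; field_simp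
  have hM1 : M 1 = b * m₁ := by rw [hm₁]; field_simp
  obtain ⟨n₀, hn₀⟩ : ∃ n₀, N 0 = a * n₀ := ⟨N 0 / a, by field_simp⟩
  obtain ⟨n₁, hn₁⟩ : ∃ n₁, N 1 = b * n₁ := ⟨N 1 / b, by field_simp⟩
  obtain ⟨l₀, hl₀⟩ : ∃ l₀, L 0 = a * l₀ := ⟨L 0 / a, by field_simp⟩
  obtain ⟨l₁, hl₁⟩ : ∃ l₁, L 1 = b * l₁ := ⟨L 1 / b, by field_simp⟩
  rw [hn₀, hn₁, mul_div_cancel_left₀ _ ha.ne', mul_div_cancel_left₀ _ hb.ne'] at hN'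
  rw [hl₀, hl₁, mul_div_cancel_left₀ _ ha.ne', mul_div_cancel_left₀ _ hb.ne'] at hL'
  rw [hM0, hM1, hn₀, hn₁, hl₀, hl₁] at hcross hdot
  have hcross' : (n₀ - m₀) * (l₁ - m₁) - (n₁ - m₁) * (l₀ - m₀) ≠ 0 := fun h0 =>
    hcross (by linear_combination a * b * h0)
  have hdual := chord_dual_conic (s := Real.sin θ) (c := Real.cos θ) ha hb hM' hN' hL' hcross'
    (by linear_combination hdot)
  have hkey := tangency_of_chord_dual_conic (κ := κ) hSpos hTpos hr hN' hdual
  rw [hdet, hn₀, hn₁, hl₀, hl₁]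
  have hc : (a * n₀ - r * κ * a * m₀) * (b * l₁ - -(r * κ * b * m₁)) -
      (b * n₁ - -(r * κ * b * m₁)) * (a * l₀ - r * κ * a * m₀) =
      a * b * (r * κ * (m₀ * (n₁ - l₁) - m₁ * (l₀ - n₀)) + (n₀ * l₁ - n₁ * l₀)) := by ring
  simp only [Matrix.cons_val_zero, Matrix.cons_val_one]
  rw [hc, mul_pow, ← hkey, hα, hβ, hγ]
  clear_value κ e
  field_simp
  ring
end
end

section
/- Let a, b > 0, let M be a point of the ellipse E(a,b), and let θ ∈ (0, π/2). Suppose c ∈ ℝ² and Q is a symmetric positive-definite 2×2 real matrix such that for all N, L on E(a,b) with M, N, L pairwise distinct and ∠NML = θ, the line through N and L is tangent to E(c,Q). If ℓ₁ and ℓ₂ are two distinct lines through M, tangent to E(c,Q) respectively at points T₁ and T₂, then the unsigned angle ∠T₁MT₂ equals π − 2θ. -/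
open EuclideanGeometry

noncomputable section

/-- The unit vector at angle `x`. -/
def unitVec (x : ℝ) : Pt := !₂[Real.cos x, Real.sin x]

/-- The determinant of two plane vectors. -/
def cross (p r : Pt) : ℝ := p 0 * r 1 - p 1 * r 0

/-- The bilinear form of the symmetric matrix `Q`. -/
def bil (Q : Matrix (Fin 2) (Fin 2) ℝ) (p r : Pt) : ℝ :=
  Q 0 0 * (p 0 * r 0) + Q 0 1 * (p 0 * r 1 + p 1 * r 0) + Q 1 1 * (p 1 * r 1)

/-- The discriminant condition for a line with direction `d` through a point `p` to be tangent
to the ellipse of center `p + v` and matrix `Q`. -/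
def TangentDir (Q : Matrix (Fin 2) (Fin 2) ℝ) (v d : Pt) : Prop :=
  Q.det * cross d v ^ 2 = bil Q d d

@[simp] lemma unitVec_zero (x : ℝ) : unitVec x 0 = Real.cos x := rfl

@[simp] lemma unitVec_one (x : ℝ) : unitVec x 1 = Real.sin x := rfl

lemma norm_unitVec (x : ℝ) : ‖unitVec x‖ = 1 := by
  simp [EuclideanSpace.norm_eq, Fin.sum_univ_two]

lemma cross_unitVec (x y : ℝ) : cross (unitVec x) (unitVec y) = Real.sin (y - x) := by
  simp only [cross, unitVec_zero, unitVec_one, Real.sin_sub]; ring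

lemma angle_unitVec {x y : ℝ} (h0 : 0 ≤ y - x) (h1 : y - x ≤ Real.pi) :
    InnerProductGeometry.angle (unitVec x) (unitVec y) = y - x := by
  rw [InnerProductGeometry.angle, norm_unitVec, norm_unitVec]
  have : inner ℝ (unitVec x) (unitVec y) = Real.cos (y - x) := by
    simp [PiLp.inner_apply, Fin.sum_univ_two, Real.cos_sub]
  rw [this, mul_one, div_one, Real.arccos_cos h0 h1]

lemma cross_smul_left (t : ℝ) (p r : Pt) : cross (t • p) r = t * cross p r := by
  simp [cross]; ring

lemma bil_smul_smul (Q : Matrix (Fin 2) (Fin 2) ℝ) (t : ℝ) (p : Pt) :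
    bil Q (t • p) (t • p) = t ^ 2 * bil Q p p := by
  simp [bil]; ring

lemma tangentDir_smul_iff {Q : Matrix (Fin 2) (Fin 2) ℝ} {v d : Pt} {t : ℝ} (ht : t ≠ 0) :
    TangentDir Q v (t • d) ↔ TangentDir Q v d := by
  rw [TangentDir, TangentDir, cross_smul_left, bil_smul_smul, mul_pow, mul_left_comm]
  exact mul_right_inj' (pow_ne_zero 2 ht)

lemma mem_ellipseQ_iff {c : Pt} {Q : Matrix (Fin 2) (Fin 2) ℝ} (hQs : Q.IsSymm) (p : Pt) :
    p ∈ ellipseQ c Q ↔ bil Q (p - c) (p - c) = 1 := by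
  have h : Q 1 0 = Q 0 1 := hQs.apply 0 1
  simp only [ellipseQ, Set.mem_ofPred_eq, Fin.sum_univ_two, bil, PiLp.sub_apply, h]
  constructor <;> intro h' <;> linarith

lemma bil_self_pos {Q : Matrix (Fin 2) (Fin 2) ℝ} (hQs : Q.IsSymm) (hQp : Q.PosDef)
    {d : Pt} (hd : d ≠ 0) : 0 < bil Q d d := by
  have hsym : Q 1 0 = Q 0 1 := hQs.apply 0 1
  have hne : (WithLp.ofLp d) ≠ 0 := by
    intro h; apply hd; ext i; simp [h]
  have := hQp.dotProduct_mulVec_pos hne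
  simp [dotProduct, Matrix.mulVec, Fin.sum_univ_two, hsym] at this
  simp only [bil]
  linarith

/-- Gram determinant identity. -/
lemma bil_gram {Q : Matrix (Fin 2) (Fin 2) ℝ} (hQs : Q.IsSymm) (d v : Pt) :
    bil Q d d * bil Q v v - bil Q d v ^ 2 = Q.det * cross d v ^ 2 := by
  have hsym : Q 1 0 = Q 0 1 := hQs.apply 0 1
  simp only [bil, cross, Matrix.det_fin_two, hsym]; ring

/-- The point of contact of a tangent line, and the tangency condition on its direction. -/
lemma tangent_line_spec {c : Pt} {Q : Matrix (Fin 2) (Fin 2) ℝ} (hQs : Q.IsSymm) (hQp : Q.PosDef)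
    {l : Set Pt} {P D T : Pt} (hl : ∀ p, p ∈ l ↔ ∃ t : ℝ, p = P + t • D) (hD : D ≠ 0)
    (hT : l ∩ ellipseQ c Q = {T}) :
    TangentDir Q (c - P) D ∧
      ∃ t : ℝ, T = P + t • D ∧ bil Q D D * t = bil Q D (c - P) := by
  have hA := bil_self_pos hQs hQp hD
  have hexp : ∀ t : ℝ, P + t • D ∈ ellipseQ c Q ↔
      bil Q D D * t ^ 2 - 2 * bil Q D (c - P) * t + bil Q (c - P) (c - P) = 1 := by
    intro t
    rw [mem_ellipseQ_iff hQs]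
    simp only [bil, PiLp.sub_apply, PiLp.add_apply, PiLp.smul_apply, smul_eq_mul]
    constructor <;> intro h <;> linarith
  have hTm : T ∈ l ∩ ellipseQ c Q := by rw [hT]; rfl
  obtain ⟨t, rfl⟩ := (hl T).1 hTm.1
  have h1 := (hexp t).1 hTm.2
  have h2 : P + (2 * bil Q D (c - P) / bil Q D D - t) • D ∈ l ∩ ellipseQ c Q := by
    refine ⟨(hl _).2 ⟨_, rfl⟩, (hexp _).2 ?_⟩
    rw [← h1]; field_simp; ring
  rw [hT, Set.mem_singleton_iff, add_right_inj] at h2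
  have h3 := smul_left_injective ℝ hD h2
  have h4 : bil Q D D * t = bil Q D (c - P) := by
    field_simp at h3; linarith
  refine ⟨?_, t, rfl, h4⟩
  rw [TangentDir, ← bil_gram hQs]
  linear_combination bil Q D D * h1 + (bil Q D (c - P) - bil Q D D * t) * h4

lemma mem_lineThrough_iff {P R p : Pt} :
    p ∈ lineThrough P R ↔ ∃ t : ℝ, p = P + t • (R - P) := by
  simp only [lineThrough, SetLike.mem_coe, mem_affineSpan_pair_iff_exists_lineMap_eq,
    AffineMap.lineMap_apply, vsub_eq_sub, vadd_eq_add]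
  exact exists_congr fun t => by rw [eq_comm, add_comm]

lemma IsLine.exists_direction {l : Set Pt} (hl : IsLine l) {M : Pt} (hM : M ∈ l) :
    ∃ e : Pt, e ≠ 0 ∧ ∀ p, p ∈ l ↔ ∃ t : ℝ, p = M + t • e := by
  obtain ⟨P, R, hPR, rfl⟩ := hl
  obtain ⟨r, rfl⟩ := mem_lineThrough_iff.1 hM
  refine ⟨R - P, sub_ne_zero.2 hPR.symm, fun p => mem_lineThrough_iff.trans ⟨?_, ?_⟩⟩
  · rintro ⟨t, rfl⟩
    exact ⟨t - r, by module⟩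
  · rintro ⟨t, rfl⟩
    exact ⟨r + t, by module⟩

/-- Expansion of a vector in a basis of the plane. -/
lemma cross_smul_eq (d₀ d₁ v : Pt) :
    cross d₀ d₁ • v = cross v d₁ • d₀ + cross d₀ v • d₁ := by
  ext i
  fin_cases i <;> simp [cross] <;> ring

/-- There are at most two directions of tangent lines from a point. -/
lemma TangentDir.eq_smul_or {Q : Matrix (Fin 2) (Fin 2) ℝ} (hQs : Q.IsSymm) (hQp : Q.PosDef)
    {v d₀ d₁ e : Pt} (hk : cross d₀ d₁ ≠ 0) (hv : v ≠ 0)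
    (h₀ : TangentDir Q v d₀) (h₁ : TangentDir Q v d₁) (he : TangentDir Q v e) :
    (∃ t : ℝ, e = t • d₀) ∨ ∃ t : ℝ, e = t • d₁ := by
  -- `h` is the polar value of the degenerate form at `d₀`, `d₁`
  set h : ℝ := Q.det * (cross d₀ v * cross d₁ v) - bil Q d₀ d₁ with hh
  have key : ∀ w : Pt, cross d₀ d₁ ^ 2 * (Q.det * cross w v ^ 2 - bil Q w w) =
      2 * (cross w d₁ * cross d₀ w) * h := by
    intro w
    have e : cross d₀ d₁ ^ 2 * (Q.det * cross w v ^ 2 - bil Q w w) =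
        cross w d₁ ^ 2 * (Q.det * cross d₀ v ^ 2 - bil Q d₀ d₀) +
        cross d₀ w ^ 2 * (Q.det * cross d₁ v ^ 2 - bil Q d₁ d₁) +
        2 * (cross w d₁ * cross d₀ w) * h := by
      rw [hh]
      simp only [cross, bil]; ring
    rw [TangentDir] at h₀ h₁
    rw [e, h₀, h₁]; ring
  have hne : h ≠ 0 := by
    intro h0
    have := key v
    have hvv : cross v v = 0 := by simp [cross]; ring
    rw [h0, hvv] at this
    have hpos := bil_self_pos hQs hQp hv
    have : cross d₀ d₁ ^ 2 * bil Q v v = 0 := by linarith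
    simp [hk, hpos.ne'] at this
  have hz := key e
  rw [he, sub_self, mul_zero, eq_comm] at hz
  have hexp := cross_smul_eq d₀ d₁ e
  have hinv : e = (cross d₀ d₁)⁻¹ • (cross d₀ d₁ • e) := by
    rw [smul_smul, inv_mul_cancel₀ hk, one_smul]
  have : cross e d₁ = 0 ∨ cross d₀ e = 0 := by simpa [hne] using hz
  rcases this with h | h
  · right
    exact ⟨_, by rw [hinv, hexp, h, zero_smul, zero_add, smul_smul]⟩
  · left
    exact ⟨_, by rw [hinv, hexp, h, zero_smul, add_zero, smul_smul]⟩

/-- If the center of the ellipse lies on the same side of two oriented tangent lines through a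
point, the points of contact have abscissae of opposite signs. -/
lemma contact_mul_neg {Q : Matrix (Fin 2) (Fin 2) ℝ} (hQs : Q.IsSymm) (hQp : Q.PosDef)
    {v d₀ d₁ : Pt} (hk : cross d₀ d₁ ≠ 0) (h₀ : TangentDir Q v d₀) (h₁ : TangentDir Q v d₁)
    (hs : 0 < cross d₀ v * cross d₁ v) {t₀ t₁ : ℝ}
    (ht₀ : bil Q d₀ d₀ * t₀ = bil Q d₀ v) (ht₁ : bil Q d₁ d₁ * t₁ = bil Q d₁ v) :
    t₀ * t₁ < 0 := by
  have hdet := hQp.det_pos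
  have hA : 0 < bil Q d₀ d₀ := by
    rw [← h₀]; exact mul_pos hdet (sq_pos_of_ne_zero (left_ne_zero_of_mul hs.ne'))
  have hC : 0 < bil Q d₁ d₁ := by
    rw [← h₁]; exact mul_pos hdet (sq_pos_of_ne_zero (right_ne_zero_of_mul hs.ne'))
  have hgram := bil_gram hQs d₀ d₁
  have e₀ : cross d₀ d₁ * bil Q d₀ v =
      cross d₀ v * bil Q d₀ d₁ - cross d₁ v * bil Q d₀ d₀ := by
    simp only [cross, bil]; ring
  have e₁ : cross d₀ d₁ * bil Q d₁ v =
      cross d₀ v * bil Q d₁ d₁ - cross d₁ v * bil Q d₀ d₁ := by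
    simp only [cross, bil]; ring
  rw [TangentDir] at h₀ h₁
  rw [← ht₀] at e₀
  rw [← ht₁] at e₁
  generalize bil Q d₀ d₀ = A at *
  generalize bil Q d₁ d₁ = C at *
  generalize bil Q d₀ d₁ = B at *
  generalize cross d₀ v = x at *
  generalize cross d₁ v = y at *
  generalize cross d₀ d₁ = k at *
  generalize Q.det = δ at *
  have hmain : (k ^ 2 * (A * C)) * (t₀ * t₁) = -(x * y * (δ * (x * y) - B) ^ 2) := by
    have : (k ^ 2 * (A * C)) * (t₀ * t₁) = (k * (A * t₀)) * (k * (C * t₁)) := by ring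
    rw [this, e₀, e₁, ← h₀, ← h₁]; ring
  have hne : δ * (x * y) - B ≠ 0 := by
    intro h
    have hB : B = δ * (x * y) := by linarith
    rw [← h₀, ← h₁, hB] at hgram
    have : δ * k ^ 2 = 0 := by rw [← hgram]; ring
    simp [hdet.ne', hk] at this
  have hneg : (k ^ 2 * (A * C)) * (t₀ * t₁) < 0 := by
    rw [hmain, neg_lt_zero]; positivity
  have hpos : 0 < k ^ 2 * (A * C) := by positivity
  exact (pos_iff_neg_of_mul_neg hneg).1 hpos

/-- Polar parametrization of an ellipse from one of its points, the angle being measured from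
the tangent line. -/
lemma exists_polar_param {a b : ℝ} (ha : 0 < a) (hb : 0 < b) {M : Pt} (hM : M ∈ ellipseE a b) :
    ∃ (τ : ℝ) (r : ℝ → ℝ), Continuous r ∧ r 0 = 0 ∧ r Real.pi = 0 ∧
      (∀ x ∈ Set.Ioo 0 Real.pi, 0 < r x) ∧ ∀ x, M + r x • unitVec (τ + x) ∈ ellipseE a b := by
  have hM' : M 0 ^ 2 / a ^ 2 + M 1 ^ 2 / b ^ 2 = 1 := hM
  set z : ℂ := ⟨-(M 1 / b ^ 2), M 0 / a ^ 2⟩ with hz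
  have hz0 : z ≠ 0 := by
    intro h
    have h0 : M 0 / a ^ 2 = 0 := congrArg Complex.im h
    have h1 : -(M 1 / b ^ 2) = 0 := congrArg Complex.re h
    have h0' : M 0 = 0 := by simpa [ha.ne'] using h0
    have h1' : M 1 = 0 := by simpa [hb.ne'] using h1
    simp [h0', h1'] at hM'
  have hG : 0 < ‖z‖ := norm_pos_iff.2 hz0
  have hc : ‖z‖ * Real.cos z.arg = -(M 1 / b ^ 2) := Complex.norm_mul_cos_arg z
  have hs : ‖z‖ * Real.sin z.arg = M 0 / a ^ 2 := Complex.norm_mul_sin_arg z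
  have hq : ∀ x, 0 < Real.cos x ^ 2 / a ^ 2 + Real.sin x ^ 2 / b ^ 2 := by
    intro x
    by_cases h : Real.cos x = 0
    · have : Real.sin x ≠ 0 := by
        intro h'; have := Real.sin_sq_add_cos_sq x; simp [h, h'] at this
      positivity
    · positivity
  refine ⟨z.arg, fun x => 2 * ‖z‖ * Real.sin x /
    (Real.cos (z.arg + x) ^ 2 / a ^ 2 + Real.sin (z.arg + x) ^ 2 / b ^ 2), ?_, by simp, by simp,
    ?_, ?_⟩
  · exact Continuous.div (by fun_prop) (by fun_prop) fun x => (hq _).ne'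
  · intro x hx
    have := Real.sin_pos_of_pos_of_lt_pi hx.1 hx.2
    exact div_pos (by positivity) (hq _)
  · intro x
    have hlin : M 0 / a ^ 2 * Real.cos (z.arg + x) + M 1 / b ^ 2 * Real.sin (z.arg + x) =
        -(‖z‖ * Real.sin x) := by
      have h1 : M 1 / b ^ 2 = -(‖z‖ * Real.cos z.arg) := by linarith
      have h2 : Real.sin x = Real.sin (z.arg + x - z.arg) := by ring_nf
      rw [h1, ← hs, h2, Real.sin_sub]; ring
    have hq' := hq (z.arg + x)
    beta_reduce
    generalize hqq : Real.cos (z.arg + x) ^ 2 / a ^ 2 + Real.sin (z.arg + x) ^ 2 / b ^ 2 = q at *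
    set t := 2 * ‖z‖ * Real.sin x / q with ht
    have htq : t * q = 2 * ‖z‖ * Real.sin x := by rw [ht]; field_simp
    simp only [ellipseE, Set.mem_ofPred_eq, PiLp.add_apply, PiLp.smul_apply, smul_eq_mul,
      unitVec_zero, unitVec_one]
    linear_combination hM' + 2 * t * hlin + t ^ 2 * hqq + t * htq

/-- The limits of the tangent chords give two tangent directions at `M`, and the center lies on
the same side of both oriented lines. -/
lemma exists_tangentDir_of_envelope {a b θ : ℝ} (ha : 0 < a) (hb : 0 < b)
    (hθ : θ ∈ Set.Ioo 0 (Real.pi / 2)) {M : Pt} (hM : M ∈ ellipseE a b)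
    {c : Pt} {Q : Matrix (Fin 2) (Fin 2) ℝ} (hQs : Q.IsSymm) (hQp : Q.PosDef)
    (hEnv : ∀ N L : Pt, N ∈ ellipseE a b → L ∈ ellipseE a b →
      M ≠ N → M ≠ L → N ≠ L → EuclideanGeometry.angle N M L = θ →
      IsTangentTo (lineThrough N L) (ellipseQ c Q)) :
    ∃ τ : ℝ, TangentDir Q (c - M) (unitVec (τ + θ)) ∧ TangentDir Q (c - M) (unitVec (τ - θ)) ∧
      0 < cross (unitVec (τ + θ)) (c - M) * cross (unitVec (τ - θ)) (c - M) := by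
  obtain ⟨hθ0, hθ2⟩ := hθ
  have hπ := Real.pi_pos
  obtain ⟨τ, r, hr, hr0, hrπ, hrpos, hrmem⟩ := exists_polar_param ha hb hM
  have hsinθ : 0 < Real.sin θ := Real.sin_pos_of_pos_of_lt_pi hθ0 (by linarith)
  let N : ℝ → Pt := fun x => M + r x • unitVec (τ + x)
  let D : ℝ → Pt := fun x => r (x + θ) • unitVec (τ + (x + θ)) - r x • unitVec (τ + x)
  have hDN : ∀ x, N (x + θ) - N x = D x := fun x => by simp [N, D]
  have hD : ∀ x ∈ Set.Icc 0 (Real.pi - θ), D x ≠ 0 := by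
    rintro x ⟨hx0, hx1⟩ h
    have hcr (y : ℝ) : cross (D x) (unitVec y) =
        r (x + θ) * Real.sin (y - (τ + (x + θ))) - r x * Real.sin (y - (τ + x)) := by
      rw [← cross_unitVec, ← cross_unitVec]; simp [D, cross]; ring
    have h0 (y : ℝ) : cross (D x) (unitVec y) = 0 := by rw [h]; simp [cross]
    have h1 := hcr (τ + x)
    have h2 := hcr (τ + (x + θ))
    rw [h0, show τ + x - (τ + (x + θ)) = -θ by ring, Real.sin_neg, sub_self, Real.sin_zero] at h1
    rw [h0, show τ + (x + θ) - (τ + x) = θ by ring, sub_self, Real.sin_zero] at h2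
    have hrx : r x = 0 := by
      have : r x * Real.sin θ = 0 := by linarith
      simpa [hsinθ.ne'] using this
    have hrx' : r (x + θ) = 0 := by
      have : r (x + θ) * Real.sin θ = 0 := by linarith
      simpa [hsinθ.ne'] using this
    rcases hx0.eq_or_lt with h | h
    · exact (hrpos (x + θ) ⟨by linarith, by linarith⟩).ne' hrx'
    · exact (hrpos x ⟨h, by linarith⟩).ne' hrx
  have htan : ∀ x ∈ Set.Ioo 0 (Real.pi - θ), TangentDir Q (c - N x) (D x) := by
    rintro x ⟨hx0, hx1⟩
    have hp := hrpos x ⟨hx0, by linarith⟩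
    have hp' := hrpos (x + θ) ⟨by linarith, by linarith⟩
    have hMN (y : ℝ) (hy : 0 < r y) : M ≠ N y := by
      intro h
      have h0 : r y • unitVec (τ + y) = 0 := by simpa [N] using h
      have := congrArg norm h0
      rw [norm_smul, norm_unitVec] at this
      simp [hy.ne'] at this
    have hNL : N x ≠ N (x + θ) := by
      intro h
      apply hD x ⟨hx0.le, hx1.le⟩
      rw [← hDN, h, sub_self]
    obtain ⟨T, hT, hTu⟩ := hEnv (N x) (N (x + θ)) (hrmem x) (hrmem _) (hMN _ hp) (hMN _ hp') hNL
      (by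
        simp only [EuclideanGeometry.angle, N, vsub_eq_sub, add_sub_cancel_left]
        rw [InnerProductGeometry.angle_smul_left_of_pos _ _ hp,
          InnerProductGeometry.angle_smul_right_of_pos _ _ hp', angle_unitVec] <;> linarith)
    refine (tangent_line_spec hQs hQp (T := T) (fun p => mem_lineThrough_iff.trans ?_)
      (hD x ⟨hx0.le, hx1.le⟩) (Set.eq_singleton_iff_unique_mem.2 ⟨hT, hTu⟩)).1
    rw [hDN]
  have hN0 : Continuous fun x => N x 0 := by
    simp only [N, PiLp.add_apply, PiLp.smul_apply, unitVec_zero]; fun_prop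
  have hN1 : Continuous fun x => N x 1 := by
    simp only [N, PiLp.add_apply, PiLp.smul_apply, unitVec_one]; fun_prop
  have hD0 : Continuous fun x => D x 0 := by
    simp only [D, PiLp.sub_apply, PiLp.smul_apply, unitVec_zero]; fun_prop
  have hD1 : Continuous fun x => D x 1 := by
    simp only [D, PiLp.sub_apply, PiLp.smul_apply, unitVec_one]; fun_prop
  have hcs : Continuous fun x => cross (D x) (c - N x) :=
    (hD0.mul (continuous_const.sub hN1)).sub (hD1.mul (continuous_const.sub hN0))
  have hcb : Continuous fun x => bil Q (D x) (D x) :=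
    ((continuous_const.mul (hD0.mul hD0)).add (continuous_const.mul ((hD0.mul hD1).add
      (hD1.mul hD0)))).add (continuous_const.mul (hD1.mul hD1))
  have htan' : ∀ x ∈ Set.Icc 0 (Real.pi - θ), TangentDir Q (c - N x) (D x) := by
    have hcl : IsClosed {x | Q.det * cross (D x) (c - N x) ^ 2 = bil Q (D x) (D x)} :=
      isClosed_eq (continuous_const.mul (hcs.pow 2)) hcb
    rw [← closure_Ioo (by linarith : (0 : ℝ) ≠ Real.pi - θ)]
    exact fun x hx => closure_minimal htan hcl hx
  have hne : ∀ x ∈ Set.Icc 0 (Real.pi - θ), cross (D x) (c - N x) ≠ 0 := by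
    intro x hx h
    have h1 := htan' x hx
    rw [TangentDir, h] at h1
    have := bil_self_pos hQs hQp (hD x hx)
    simp at h1
    linarith
  have hle : (0 : ℝ) ≤ Real.pi - θ := by linarith
  have hprod : 0 < cross (D 0) (c - N 0) *
      cross (D (Real.pi - θ)) (c - N (Real.pi - θ)) := by
    by_contra! hcon
    have hmem : (0 : ℝ) ∈ Set.uIcc (cross (D 0) (c - N 0))
        (cross (D (Real.pi - θ)) (c - N (Real.pi - θ))) := by
      rw [Set.mem_uIcc]
      rcases mul_nonpos_iff.1 hcon with h | h
      · exact Or.inr ⟨h.2, h.1⟩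
      · exact Or.inl ⟨h.1, h.2⟩
    obtain ⟨x, hx, hx0⟩ := intermediate_value_uIcc hcs.continuousOn hmem
    rw [Set.uIcc_of_le hle] at hx
    exact hne x hx hx0
  have hpθ := hrpos θ ⟨hθ0, by linarith⟩
  have hpθ' := hrpos (Real.pi - θ) ⟨by linarith, by linarith⟩
  have hNz : N 0 = M := by simp [N, hr0]
  have hDz : D 0 = r θ • unitVec (τ + θ) := by simp [D, hr0]
  have hu : unitVec (τ + (Real.pi - θ)) = -unitVec (τ - θ) := by
    have h : τ + (Real.pi - θ) = τ - θ + Real.pi := by ring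
    ext i
    fin_cases i <;> simp [h, Real.cos_add_pi, Real.sin_add_pi]
  have hDπ : D (Real.pi - θ) = r (Real.pi - θ) • unitVec (τ - θ) := by
    simp [D, hrπ, hu]
  have hNπ : N (Real.pi - θ) = M - r (Real.pi - θ) • unitVec (τ - θ) := by
    simp only [N, hu, smul_neg, sub_eq_add_neg _ (r (Real.pi - θ) • _)]
  have hcπ : cross (D (Real.pi - θ)) (c - N (Real.pi - θ)) =
      cross (D (Real.pi - θ)) (c - M) := by
    rw [hNπ, hDπ]; simp [cross]; ring
  have t₀ := htan' 0 ⟨le_rfl, hle⟩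
  have t₁ := htan' (Real.pi - θ) ⟨hle, le_rfl⟩
  rw [TangentDir, hcπ, ← TangentDir, hDπ, tangentDir_smul_iff hpθ'.ne'] at t₁
  rw [hNz, hDz, tangentDir_smul_iff hpθ.ne'] at t₀
  rw [hcπ, hNz, hDz, hDπ, cross_smul_left, cross_smul_left] at hprod
  refine ⟨τ, t₀, t₁, ?_⟩
  refine pos_of_mul_pos_right (a := r θ * r (Real.pi - θ)) ?_ (by positivity)
  linarith

/-- **Optic property of the Frégier ellipse.** If `E(c,Q)` is a Frégier ellipse of `M`
for angle `θ ∈ (0, π/2)`, then the two tangent lines from `M` to `E(c,Q)`, touching it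
at `T₁` and `T₂`, make the constant angle `π − 2θ` at `M`. -/
theorem fregier_optic (a b θ : ℝ) (ha : 0 < a) (hb : 0 < b)
    (hθ : θ ∈ Set.Ioo 0 (Real.pi / 2))
    (M : Pt) (hM : M ∈ ellipseE a b)
    (c : Pt) (Q : Matrix (Fin 2) (Fin 2) ℝ) (hQs : Q.IsSymm) (hQp : Q.PosDef)
    (hEnv : ∀ N L : Pt, N ∈ ellipseE a b → L ∈ ellipseE a b →
      M ≠ N → M ≠ L → N ≠ L → EuclideanGeometry.angle N M L = θ →
      IsTangentTo (lineThrough N L) (ellipseQ c Q))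
    (l₁ l₂ : Set Pt) (hl₁ : IsLine l₁) (hl₂ : IsLine l₂) (hll : l₁ ≠ l₂)
    (hMl₁ : M ∈ l₁) (hMl₂ : M ∈ l₂)
    (T₁ T₂ : Pt)
    (htan₁ : l₁ ∩ ellipseQ c Q = {T₁}) (htan₂ : l₂ ∩ ellipseQ c Q = {T₂}) :
    EuclideanGeometry.angle T₁ M T₂ = Real.pi - 2 * θ := by
  obtain ⟨τ, h₀, h₁, hs⟩ := exists_tangentDir_of_envelope ha hb hθ hM hQs hQp hEnv
  obtain ⟨hθ0, hθ2⟩ := hθ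
  have hk : cross (unitVec (τ + θ)) (unitVec (τ - θ)) ≠ 0 := by
    rw [cross_unitVec, show τ - θ - (τ + θ) = -(2 * θ) by ring, Real.sin_neg, neg_ne_zero]
    exact (Real.sin_pos_of_pos_of_lt_pi (by linarith) (by linarith)).ne'
  have hv : c - M ≠ 0 := by
    intro h; simp [h, cross] at hs
  have hang : InnerProductGeometry.angle (unitVec (τ + θ)) (unitVec (τ - θ)) = 2 * θ := by
    rw [InnerProductGeometry.angle_comm, angle_unitVec] <;> linarith
  -- each tangent line through `M` is directed by one of the two limit directions
  have hdir : ∀ (l : Set Pt) (T : Pt), IsLine l → M ∈ l → l ∩ ellipseQ c Q = {T} →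
      ∃ d : Pt, (d = unitVec (τ + θ) ∨ d = unitVec (τ - θ)) ∧
        (∀ p, p ∈ l ↔ ∃ t : ℝ, p = M + t • d) ∧
        ∃ t : ℝ, T = M + t • d ∧ bil Q d d * t = bil Q d (c - M) := by
    intro l T hl hMl hT
    obtain ⟨e, he, hle⟩ := hl.exists_direction hMl
    obtain ⟨d, hd, s, rfl⟩ : ∃ d : Pt, (d = unitVec (τ + θ) ∨ d = unitVec (τ - θ)) ∧
        ∃ s : ℝ, e = s • d := by
      rcases TangentDir.eq_smul_or hQs hQp hk hv h₀ h₁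
        (tangent_line_spec hQs hQp hle he hT).1 with h | h
      · exact ⟨_, Or.inl rfl, h⟩
      · exact ⟨_, Or.inr rfl, h⟩
    have hs0 : s ≠ 0 := left_ne_zero_of_smul he
    have hld : ∀ p, p ∈ l ↔ ∃ t : ℝ, p = M + t • d := by
      refine fun p => (hle p).trans ⟨?_, ?_⟩
      · rintro ⟨t, rfl⟩
        exact ⟨t * s, by rw [smul_smul]⟩
      · rintro ⟨t, rfl⟩
        exact ⟨t * s⁻¹, by rw [smul_smul, inv_mul_cancel_right₀ hs0]⟩
    exact ⟨d, hd, hld, (tangent_line_spec hQs hQp hld (right_ne_zero_of_smul he) hT).2⟩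
  have hangle : ∀ t₀ t₁ : ℝ, t₀ * t₁ < 0 → EuclideanGeometry.angle (M + t₀ • unitVec (τ + θ)) M
      (M + t₁ • unitVec (τ - θ)) = Real.pi - 2 * θ := by
    intro t₀ t₁ h
    simp only [EuclideanGeometry.angle, vsub_eq_sub, add_sub_cancel_left]
    rcases mul_neg_iff.1 h with ⟨h0, h1⟩ | ⟨h0, h1⟩
    · rw [InnerProductGeometry.angle_smul_left_of_pos _ _ h0,
        InnerProductGeometry.angle_smul_right_of_neg _ _ h1,
        InnerProductGeometry.angle_neg_right, hang]
    · rw [InnerProductGeometry.angle_smul_left_of_neg _ _ h0,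
        InnerProductGeometry.angle_smul_right_of_pos _ _ h1,
        InnerProductGeometry.angle_neg_left, hang]
  obtain ⟨d, hd, hld, t, rfl, ht⟩ := hdir l₁ T₁ hl₁ hMl₁ htan₁
  obtain ⟨d', hd', hld', t', rfl, ht'⟩ := hdir l₂ T₂ hl₂ hMl₂ htan₂
  have hdd : d ≠ d' := by
    rintro rfl
    exact hll (Set.ext fun p => (hld p).trans (hld' p).symm)
  rcases hd with rfl | rfl <;> rcases hd' with rfl | rfl
  · exact absurd rfl hdd
  · exact hangle _ _ (contact_mul_neg hQs hQp hk h₀ h₁ hs ht ht')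
  · rw [EuclideanGeometry.angle_comm]
    exact hangle _ _ (contact_mul_neg hQs hQp hk h₀ h₁ hs ht' ht)
  · exact absurd rfl hdd
end
end

section
/- Let R > 0 and let M, T₁, T₂ be pairwise distinct points on the circle of radius R centered at the origin of ℝ². Suppose the lines through M and T₁ and through M and T₂ are each tangent to the concentric circle of radius R/2 (equivalently, each lies at distance R/2 from the origin). Then the line through T₁ and T₂ is also tangent to the circle of radius R/2; that is, the triangle M T₁ T₂ circumscribes the concentric circle of half the radius (and is equilateral). -/
open EuclideanGeometry

noncomputable section

/-- The distance from the origin to a chord's line is the norm of the chord's midpoint. -/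
theorem infDist_zero_affineSpan_pair_of_norm_eq {E : Type*} [NormedAddCommGroup E]
    [InnerProductSpace ℝ E] {P Q : E} (h : ‖P‖ = ‖Q‖) :
    Metric.infDist (0 : E) (affineSpan ℝ {P, Q} : Set E) = ‖P + Q‖ / 2 := by
  apply le_antisymm
  · have hmem : midpoint ℝ P Q ∈ (affineSpan ℝ {P, Q} : Set E) :=
      AffineMap.lineMap_mem_affineSpan_pair _ _ _
    refine (Metric.infDist_le_dist_of_mem hmem).trans_eq ?_
    rw [dist_zero_left, midpoint_eq_smul_add, norm_smul]
    simp
    ring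
  · refine (Metric.le_infDist ⟨P, left_mem_affineSpan_pair ℝ P Q⟩).2 fun x hx => ?_
    obtain ⟨t, rfl⟩ := mem_affineSpan_pair_iff_exists_lineMap_eq.1 hx
    rw [dist_zero_left]
    have hinner : inner ℝ (P + Q) (Q - P) = 0 := by
      rw [add_comm, real_inner_add_sub_eq_zero_iff, h]
    have hsplit : AffineMap.lineMap P Q t
        = (1 / 2 : ℝ) • (P + Q) + (t - 1 / 2) • (Q - P) := by
      rw [AffineMap.lineMap_apply_module]
      module
    have hsq : ‖AffineMap.lineMap P Q t‖ ^ 2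
        = (‖P + Q‖ / 2) ^ 2 + ((t - 1 / 2) * ‖Q - P‖) ^ 2 := by
      rw [hsplit, norm_add_sq_real, inner_smul_left, inner_smul_right, hinner, norm_smul,
        norm_smul, mul_pow, mul_pow, Real.norm_eq_abs, Real.norm_eq_abs, sq_abs, sq_abs]
      ring
    exact le_of_sq_le_sq (hsq ▸ le_add_of_nonneg_right (sq_nonneg _)) (norm_nonneg _)

/-- For vectors of norm `R`, the sum has norm `R` exactly when the inner product is `-R ^ 2 / 2`. -/
theorem norm_add_eq_iff_inner_eq {E : Type*} [NormedAddCommGroup E]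
    [InnerProductSpace ℝ E] {P Q : E} {R : ℝ} (hP : ‖P‖ = R) (hQ : ‖Q‖ = R) :
    ‖P + Q‖ = R ↔ inner ℝ P Q = -R ^ 2 / 2 := by
  have hR : 0 ≤ R := hP ▸ norm_nonneg P
  rw [← sq_eq_sq₀ (norm_nonneg _) hR, norm_add_sq_real, hP, hQ]
  constructor <;> intro h <;> linarith

/-- A chord of the circle of radius `R` lies at distance `R / 2` from the center exactly when its
endpoints have inner product `-R ^ 2 / 2`. -/
theorem infDist_lineThrough_eq_half_iff {P Q : Pt} {R : ℝ} (hP : ‖P‖ = R) (hQ : ‖Q‖ = R) :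
    Metric.infDist (0 : Pt) (lineThrough P Q) = R / 2 ↔ inner ℝ P Q = -R ^ 2 / 2 := by
  rw [lineThrough, infDist_zero_affineSpan_pair_of_norm_eq (hP.trans hQ.symm),
    ← norm_add_eq_iff_inner_eq hP hQ]
  constructor <;> intro h <;> linarith

/-- **Poncelet closure for the circle of half radius.** If `M`, `T₁`, `T₂` lie on the
circle of radius `R` and the lines `MT₁`, `MT₂` are tangent to the concentric circle of
radius `R/2` (i.e. lie at distance `R/2` from the origin), then so is the line `T₁T₂`:
the triangle `M T₁ T₂` circumscribes the circle of half radius. -/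
theorem halfradius_poncelet (R : ℝ) (hR : 0 < R) (M T₁ T₂ : Pt)
    (hM : ‖M‖ = R) (h1 : ‖T₁‖ = R) (h2 : ‖T₂‖ = R)
    (hd1 : M ≠ T₁) (hd2 : M ≠ T₂) (hd3 : T₁ ≠ T₂)
    (ht1 : Metric.infDist (0 : Pt) (lineThrough M T₁) = R / 2)
    (ht2 : Metric.infDist (0 : Pt) (lineThrough M T₂) = R / 2) :
    Metric.infDist (0 : Pt) (lineThrough T₁ T₂) = R / 2 := by
  rw [infDist_lineThrough_eq_half_iff hM h1] at ht1
  rw [infDist_lineThrough_eq_half_iff hM h2] at ht2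
  rw [infDist_lineThrough_eq_half_iff h1 h2]
  have nM : M 0 ^ 2 + M 1 ^ 2 = R ^ 2 := by
    rw [← hM, EuclideanSpace.real_norm_sq_eq, Fin.sum_univ_two]
  have n1 : T₁ 0 ^ 2 + T₁ 1 ^ 2 = R ^ 2 := by
    rw [← h1, EuclideanSpace.real_norm_sq_eq, Fin.sum_univ_two]
  have n2 : T₂ 0 ^ 2 + T₂ 1 ^ 2 = R ^ 2 := by
    rw [← h2, EuclideanSpace.real_norm_sq_eq, Fin.sum_univ_two]
  simp only [PiLp.inner_apply, Fin.sum_univ_two, RCLike.inner_apply, conj_trivial] at ht1 ht2 ⊢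
  have hR2 : R ^ 2 ≠ 0 := by positivity
  have cross_sq : (M 0 * T₁ 1 - M 1 * T₁ 0) ^ 2 = 3 / 4 * R ^ 4 := by
    linear_combination (T₁ 0 ^ 2 + T₁ 1 ^ 2) * nM + R ^ 2 * n1
      - (T₁ 0 * M 0 + T₁ 1 * M 1 - R ^ 2 / 2) * ht1
  have cross_sq' : (M 0 * T₂ 1 - M 1 * T₂ 0) ^ 2 = 3 / 4 * R ^ 4 := by
    linear_combination (T₂ 0 ^ 2 + T₂ 1 ^ 2) * nM + R ^ 2 * n2
      - (T₂ 0 * M 0 + T₂ 1 * M 1 - R ^ 2 / 2) * ht2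
  rcases sq_eq_sq_iff_eq_or_eq_neg.1 (cross_sq.trans cross_sq'.symm) with h | h
  · refine absurd ?_ hd3
    ext i
    fin_cases i
    · refine mul_left_cancel₀ hR2 (?_ : R ^ 2 * T₁ 0 = R ^ 2 * T₂ 0)
      linear_combination M 0 * (ht1 - ht2) - M 1 * h - (T₁ 0 - T₂ 0) * nM
    · refine mul_left_cancel₀ hR2 (?_ : R ^ 2 * T₁ 1 = R ^ 2 * T₂ 1)
      linear_combination M 1 * (ht1 - ht2) + M 0 * h - (T₁ 1 - T₂ 1) * nM
  · refine mul_left_cancel₀ hR2 ?_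
    linear_combination -(T₁ 0 * T₂ 0 + T₁ 1 * T₂ 1) * nM
      + (T₂ 0 * M 0 + T₂ 1 * M 1) * ht1 - R ^ 2 / 2 * ht2
      + (M 0 * T₂ 1 - M 1 * T₂ 0) * h - cross_sq'
end
end

section
/- Let R > 0 and 0 < q ≤ p < R, and let C be the concentric ellipse {(x,y) ∈ ℝ² : x²/p² + y²/q² = 1}. Let P₁, P₂, P₃ and P₁′, P₂′, P₃′ each be triples of non-collinear points on the circle of radius R centered at the origin of ℝ², such that for each triple all three side lines (the lines through P₁P₂, P₂P₃, P₃P₁, and respectively through P₁′P₂′, P₂′P₃′, P₃′P₁′) are tangent to C. Then ‖P₁−P₂‖² + ‖P₂−P₃‖² + ‖P₃−P₁‖² = ‖P₁′−P₂′‖² + ‖P₂′−P₃′‖² + ‖P₃′−P₁′‖²; that is, the sum of the squared side lengths is the same for every triangle of the Poncelet circle–ellipse family. -/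
open EuclideanGeometry

noncomputable section

/-- If a bilinear form takes the value `c` at all pairs of three points of a circle, then the
second and third points are the intersections of the circle with a line determined by the first. -/
lemma polar_chord_relations {a b c r x₁ y₁ x₂ y₂ x₃ y₃ : ℝ}
    (hN : 0 < (a * x₁) ^ 2 + (b * y₁) ^ 2)
    (h2 : x₂ ^ 2 + y₂ ^ 2 = r) (h3 : x₃ ^ 2 + y₃ ^ 2 = r)
    (e12 : a * (x₁ * x₂) + b * (y₁ * y₂) = c) (e31 : a * (x₃ * x₁) + b * (y₃ * y₁) = c)
    (e23 : a * (x₂ * x₃) + b * (y₂ * y₃) = c) (hne : ¬ (x₂ = x₃ ∧ y₂ = y₃)) :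
    ((a * x₁) ^ 2 + (b * y₁) ^ 2) * (x₂ + x₃) = 2 * c * (a * x₁) ∧
      ((a * x₁) ^ 2 + (b * y₁) ^ 2) * (y₂ + y₃) = 2 * c * (b * y₁) ∧
      (a + b) * c ^ 2 = (c + r * b) * a ^ 2 * x₁ ^ 2 + (c + r * a) * b ^ 2 * y₁ ^ 2 := by
  set u := a * x₁ with hu
  set v := b * y₁ with hv
  have l2 : u * x₂ + v * y₂ = c := by rw [hu, hv]; linarith
  have l3 : u * x₃ + v * y₃ = c := by rw [hu, hv]; linarith
  have hpar : u * (y₂ + y₃) - v * (x₂ + x₃) = 0 := by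
    have hx : (x₂ - x₃) * (u * (y₂ + y₃) - v * (x₂ + x₃)) = 0 := by
      linear_combination (y₂ + y₃) * (l2 - l3) - v * (h2 - h3)
    have hy : (y₂ - y₃) * (u * (y₂ + y₃) - v * (x₂ + x₃)) = 0 := by
      linear_combination -(x₂ + x₃) * (l2 - l3) + u * (h2 - h3)
    by_contra h
    exact hne ⟨sub_eq_zero.1 ((mul_eq_zero.1 hx).resolve_right h),
      sub_eq_zero.1 ((mul_eq_zero.1 hy).resolve_right h)⟩
  have hsx : (u ^ 2 + v ^ 2) * (x₂ + x₃) = 2 * c * u := by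
    linear_combination u * (l2 + l3) - v * hpar
  have hsy : (u ^ 2 + v ^ 2) * (y₂ + y₃) = 2 * c * v := by
    linear_combination v * (l2 + l3) + u * hpar
  have hd : (u ^ 2 + v ^ 2) * (r + (x₂ * x₃ + y₂ * y₃)) = 2 * c ^ 2 := by
    apply mul_left_cancel₀ (mul_ne_zero two_ne_zero hN.ne')
    linear_combination (u ^ 2 + v ^ 2) * (x₂ + x₃) * hsx + 2 * c * u * hsx
      + (u ^ 2 + v ^ 2) * (y₂ + y₃) * hsy + 2 * c * v * hsy
      - (u ^ 2 + v ^ 2) ^ 2 * (h2 + h3)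
  have hxx : (u ^ 2 + v ^ 2) * (x₂ * x₃) = c ^ 2 - r * v ^ 2 := by
    apply mul_left_cancel₀ hN.ne'
    linear_combination (u ^ 2 + v ^ 2) * (u * x₃ * l2 + (c - v * y₂) * l3)
      - c * v * hsy + v ^ 2 * hd
  have hyy : (u ^ 2 + v ^ 2) * (y₂ * y₃) = c ^ 2 - r * u ^ 2 := by
    linear_combination hd - hxx
  refine ⟨hsx, hsy, ?_⟩
  linear_combination (u ^ 2 + v ^ 2) * e23 - a * hxx - b * hyy

/-- The squared length of the sum of three points of a circle that are pairwise conjugate. -/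
lemma norm_sq_sum_of_conjugate {a b c r x₁ y₁ x₂ y₂ x₃ y₃ : ℝ}
    (ha : 0 < a) (hb : 0 < b) (hr : 0 < r) (hab : a + b = 2 * r) (hc : c < r ^ 2)
    (h1 : x₁ ^ 2 + y₁ ^ 2 = r) (h2 : x₂ ^ 2 + y₂ ^ 2 = r) (h3 : x₃ ^ 2 + y₃ ^ 2 = r)
    (e12 : a * (x₁ * x₂) + b * (y₁ * y₂) = c) (e23 : a * (x₂ * x₃) + b * (y₂ * y₃) = c)
    (e31 : a * (x₃ * x₁) + b * (y₃ * y₁) = c)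
    (n12 : ¬ (x₁ = x₂ ∧ y₁ = y₂)) (n23 : ¬ (x₂ = x₃ ∧ y₂ = y₃))
    (n31 : ¬ (x₃ = x₁ ∧ y₃ = y₁)) :
    r * ((x₁ + x₂ + x₃) ^ 2 + (y₁ + y₂ + y₃) ^ 2) = r ^ 2 + 2 * c := by
  have pos {s t x y : ℝ} (hs : 0 < s) (ht : 0 < t) (h : x ^ 2 + y ^ 2 = r) :
      0 < s * x ^ 2 + t * y ^ 2 := by
    rcases eq_or_ne x 0 with rfl | hx
    · have : 0 < y ^ 2 := by linarith
      positivity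
    · positivity
  have pos' {x y : ℝ} (h : x ^ 2 + y ^ 2 = r) : 0 < (a * x) ^ 2 + (b * y) ^ 2 := by
    rw [mul_pow, mul_pow]
    exact pos (by positivity) (by positivity) h
  have hN := pos' h1
  obtain ⟨hsx, hsy, E1⟩ := polar_chord_relations hN h2 h3 e12 e31 e23 n23
  obtain ⟨-, -, E2⟩ := polar_chord_relations (pos' h2) h3 h1 e23 e12 e31 n31
  obtain ⟨-, -, E3⟩ := polar_chord_relations (pos' h3) h1 h2 e31 e23 e12 n12
  have hK : a ^ 2 * (c + r * b) - b ^ 2 * (c + r * a) = 0 := by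
    by_contra hK
    have k2 : x₂ ^ 2 = x₁ ^ 2 := by
      apply mul_left_cancel₀ hK
      linear_combination E1 - E2 + b ^ 2 * (c + r * a) * (h1 - h2)
    have k3 : x₃ ^ 2 = x₁ ^ 2 := by
      apply mul_left_cancel₀ hK
      linear_combination E1 - E3 + b ^ 2 * (c + r * a) * (h1 - h3)
    have m2 : y₂ ^ 2 = y₁ ^ 2 := by linarith
    have m3 : y₃ ^ 2 = y₁ ^ 2 := by linarith
    have hp := pos ha hb h1
    rcases sq_eq_sq_iff_eq_or_eq_neg.1 k2 with rfl | rfl <;>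
    rcases sq_eq_sq_iff_eq_or_eq_neg.1 k3 with rfl | rfl <;>
    rcases sq_eq_sq_iff_eq_or_eq_neg.1 m2 with rfl | rfl <;>
    rcases sq_eq_sq_iff_eq_or_eq_neg.1 m3 with rfl | rfl <;>
    first
      | exact n12 ⟨rfl, rfl⟩
      | exact n23 ⟨rfl, rfl⟩
      | exact n31 ⟨rfl, rfl⟩
      | nlinarith
  have hc2 : 2 * c = -(a * b) := by
    have hfac : (a - b) * (2 * c + a * b) = 0 := by
      apply mul_left_cancel₀ hr.ne'
      linear_combination hK - (a - b) * c * hab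
    rcases mul_eq_zero.1 hfac with h | h
    · have hb' : b = r := by linarith
      have ha' : a = r := by linarith
      subst hb' ha'
      have : (c - a ^ 2) * (2 * c + a ^ 2) = 0 := by
        apply mul_left_cancel₀ hr.ne'
        linear_combination E1 + (c + a * a) * a ^ 2 * h1
      rcases mul_eq_zero.1 this with h | h
      · linarith
      · linarith
    · linarith
  apply mul_left_cancel₀ hN.ne'
  have hH : ((a * x₁) ^ 2 + (b * y₁) ^ 2) * ((x₁ + x₂ + x₃) ^ 2 + (y₁ + y₂ + y₃) ^ 2) =
      ((a * x₁) ^ 2 + (b * y₁) ^ 2) * r + 4 * c * (a * x₁ ^ 2 + b * y₁ ^ 2) + 4 * c ^ 2 := by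
    apply mul_left_cancel₀ hN.ne'
    generalize hn : (a * x₁) ^ 2 + (b * y₁) ^ 2 = n at *
    linear_combination n ^ 2 * h1 + (2 * n * x₁ + n * (x₂ + x₃) + 2 * c * (a * x₁)) * hsx
      + (2 * n * y₁ + n * (y₂ + y₃) + 2 * c * (b * y₁)) * hsy + 4 * c ^ 2 * hn
  have hkey : 2 * r * (a * x₁ ^ 2 + b * y₁ ^ 2 + c) = (a * x₁) ^ 2 + (b * y₁) ^ 2 := by
    linear_combination r * hc2 - (a * x₁ ^ 2 + b * y₁ ^ 2) * hab + a * b * h1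
  linear_combination r * hH + 2 * c * hkey

/-- A line meeting an ellipse exactly once satisfies the discriminant condition. -/
lemma IsTangentTo.sq_cross_eq {p q : ℝ} (hp : 0 < p) (hq : 0 < q) {P Q : Pt}
    (hne : ¬ (P 0 = Q 0 ∧ P 1 = Q 1))
    (h : IsTangentTo (lineThrough P Q) {x : Pt | x 0 ^ 2 / p ^ 2 + x 1 ^ 2 / q ^ 2 = 1}) :
    (P 0 * Q 1 - Q 0 * P 1) ^ 2 =
      q ^ 2 * (Q 0 - P 0) ^ 2 + p ^ 2 * (Q 1 - P 1) ^ 2 := by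
  have hmem (x : Pt) : x 0 ^ 2 / p ^ 2 + x 1 ^ 2 / q ^ 2 = 1 ↔
      q ^ 2 * x 0 ^ 2 + p ^ 2 * x 1 ^ 2 = p ^ 2 * q ^ 2 := by
    field_simp
  obtain ⟨z, ⟨hzl, hzC⟩, huniq⟩ := h
  obtain ⟨t, rfl⟩ := mem_affineSpan_pair_iff_exists_lineMap_eq.1 hzl
  have coord (s : ℝ) (i : Fin 2) : AffineMap.lineMap P Q s i = P i + s * (Q i - P i) := by
    simp [AffineMap.lineMap_apply]; ring
  have hroot := (hmem _).1 hzC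
  rw [coord, coord] at hroot
  have hα : 0 < q ^ 2 * (Q 0 - P 0) ^ 2 + p ^ 2 * (Q 1 - P 1) ^ 2 := by
    by_cases h0 : P 0 = Q 0
    · have : Q 1 - P 1 ≠ 0 := fun h => hne ⟨h0, by linarith⟩
      positivity
    · have : Q 0 - P 0 ≠ 0 := fun h => h0 (by linarith)
      positivity
  set α := q ^ 2 * (Q 0 - P 0) ^ 2 + p ^ 2 * (Q 1 - P 1) ^ 2 with hαdef
  set β := q ^ 2 * P 0 * (Q 0 - P 0) + p ^ 2 * P 1 * (Q 1 - P 1) with hβdef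
  obtain ⟨s, hs⟩ : ∃ s, α * (s + t) = -2 * β := ⟨-2 * β / α - t, by field_simp; ring⟩
  have hs' := huniq (AffineMap.lineMap P Q s) ⟨AffineMap.lineMap_mem_affineSpan_pair .., by
    refine (hmem _).2 ?_
    rw [coord, coord]
    linear_combination hroot + (s - t) * hs⟩
  have hst : s = t := by
    refine AffineMap.lineMap_injective ℝ (fun h => hne ?_) hs'
    simp [h]
  subst hst
  have hβ : α * s = -β := by linarith
  apply mul_left_cancel₀ (mul_ne_zero (pow_ne_zero 2 hp.ne') (pow_ne_zero 2 hq.ne'))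
  linear_combination α * hroot - (α * s + β) * hβ

/-- For a chord of a circle, tangency to the concentric ellipse says that its endpoints are
conjugate with respect to a fixed diagonal bilinear form. -/
lemma IsTangentTo.conjugate {r p q : ℝ} (hp : 0 < p) (hq : 0 < q) {P Q : Pt}
    (hP : P 0 ^ 2 + P 1 ^ 2 = r) (hQ : Q 0 ^ 2 + Q 1 ^ 2 = r)
    (hne : ¬ (P 0 = Q 0 ∧ P 1 = Q 1))
    (h : IsTangentTo (lineThrough P Q) {x : Pt | x 0 ^ 2 / p ^ 2 + x 1 ^ 2 / q ^ 2 = 1}) :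
    (r - (p ^ 2 - q ^ 2)) * (P 0 * Q 0) + (r + (p ^ 2 - q ^ 2)) * (P 1 * Q 1) =
      (p ^ 2 + q ^ 2 - r) * r := by
  have ht := h.sq_cross_eq hp hq hne
  generalize P 0 = x₁, P 1 = y₁, Q 0 = x₂, Q 1 = y₂ at *
  have hd : r - (x₁ * x₂ + y₁ * y₂) ≠ 0 := fun h0 => hne
    ⟨by nlinarith [sq_nonneg (x₁ - x₂), sq_nonneg (y₁ - y₂)],
     by nlinarith [sq_nonneg (x₁ - x₂), sq_nonneg (y₁ - y₂)]⟩
  have hx : r * (x₂ - x₁) ^ 2 =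
      (r - (x₁ * x₂ + y₁ * y₂)) * (r - (x₁ * x₂ - y₁ * y₂)) := by
    linear_combination y₂ ^ 2 * hP + (r - x₁ ^ 2) * hQ
  have hy : r * (y₂ - y₁) ^ 2 =
      (r - (x₁ * x₂ + y₁ * y₂)) * (r + (x₁ * x₂ - y₁ * y₂)) := by
    linear_combination x₂ ^ 2 * hP + (r - y₁ ^ 2) * hQ
  have hcr : (x₁ * y₂ - x₂ * y₁) ^ 2 =
      (r - (x₁ * x₂ + y₁ * y₂)) * (r + (x₁ * x₂ + y₁ * y₂)) := by
    linear_combination (x₂ ^ 2 + y₂ ^ 2) * hP + r * hQ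
  apply mul_left_cancel₀ hd
  linear_combination r * ht - r * hcr + q ^ 2 * hx + p ^ 2 * hy

/-- The sum of the squared sides of a triangle inscribed in a circle and circumscribed about a
concentric ellipse. -/
lemma sum_sq_sides_eq {R p q : ℝ} (hq : 0 < q) (hqp : q ≤ p) (hpR : p < R)
    {P₁ P₂ P₃ : Pt} (h1 : ‖P₁‖ = R) (h2 : ‖P₂‖ = R) (h3 : ‖P₃‖ = R)
    (hncol : ¬ Collinear ℝ ({P₁, P₂, P₃} : Set Pt))
    (ht12 : IsTangentTo (lineThrough P₁ P₂) {x : Pt | x 0 ^ 2 / p ^ 2 + x 1 ^ 2 / q ^ 2 = 1})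
    (ht23 : IsTangentTo (lineThrough P₂ P₃) {x : Pt | x 0 ^ 2 / p ^ 2 + x 1 ^ 2 / q ^ 2 = 1})
    (ht31 : IsTangentTo (lineThrough P₃ P₁) {x : Pt | x 0 ^ 2 / p ^ 2 + x 1 ^ 2 / q ^ 2 = 1}) :
    ‖P₁ - P₂‖ ^ 2 + ‖P₂ - P₃‖ ^ 2 + ‖P₃ - P₁‖ ^ 2 = 10 * R ^ 2 - 2 * (p ^ 2 + q ^ 2) := by
  have hp : 0 < p := hq.trans_le hqp
  have hR : 0 < R := hp.trans hpR
  have norm_sq (P : Pt) : ‖P‖ ^ 2 = P 0 ^ 2 + P 1 ^ 2 := by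
    rw [EuclideanSpace.real_norm_sq_eq, Fin.sum_univ_two]
  have ext_iff (P Q : Pt) : P 0 = Q 0 ∧ P 1 = Q 1 ↔ P = Q := by
    refine ⟨fun h => ?_, fun h => by simp [h]⟩
    ext i
    fin_cases i
    exacts [h.1, h.2]
  have k1 : P₁ 0 ^ 2 + P₁ 1 ^ 2 = R ^ 2 := by rw [← norm_sq, h1]
  have k2 : P₂ 0 ^ 2 + P₂ 1 ^ 2 = R ^ 2 := by rw [← norm_sq, h2]
  have k3 : P₃ 0 ^ 2 + P₃ 1 ^ 2 = R ^ 2 := by rw [← norm_sq, h3]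
  have n12 : ¬ (P₁ 0 = P₂ 0 ∧ P₁ 1 = P₂ 1) := by
    rw [ext_iff]
    rintro rfl
    exact hncol (by simpa using collinear_pair ℝ P₁ P₃)
  have n23 : ¬ (P₂ 0 = P₃ 0 ∧ P₂ 1 = P₃ 1) := by
    rw [ext_iff]
    rintro rfl
    exact hncol (by simpa using collinear_pair ℝ P₁ P₂)
  have n31 : ¬ (P₃ 0 = P₁ 0 ∧ P₃ 1 = P₁ 1) := by
    rw [ext_iff]
    rintro rfl
    exact hncol (by simpa [Set.pair_comm] using collinear_pair ℝ P₃ P₂)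
  have hqp2 : q ^ 2 ≤ p ^ 2 := by gcongr
  have hpR2 : p ^ 2 < R ^ 2 := by gcongr
  have hq2 : 0 < q ^ 2 := by positivity
  have hR2 : 0 < R ^ 2 := by positivity
  have hH := norm_sq_sum_of_conjugate (by linarith) (by linarith) hR2 (by ring)
    (by nlinarith) k1 k2 k3 (ht12.conjugate hp hq k1 k2 n12) (ht23.conjugate hp hq k2 k3 n23)
    (ht31.conjugate hp hq k3 k1 n31) n12 n23 n31
  simp only [norm_sq, PiLp.sub_apply]
  apply mul_left_cancel₀ hR2.ne'
  linear_combination 3 * R ^ 2 * (k1 + k2 + k3) - hH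

/-- **Poncelet invariant: sum of squared side lengths.** For any two triangles inscribed
in the circle of radius `R` and circumscribing the concentric ellipse
`x²/p² + y²/q² = 1` (with `0 < q ≤ p < R`), the sums of squared side lengths agree. -/
theorem poncelet_sq_sides_invariant (R p q : ℝ) (hq : 0 < q) (hqp : q ≤ p) (hpR : p < R)
    (C : Set Pt) (hC : C = {x : Pt | x 0 ^ 2 / p ^ 2 + x 1 ^ 2 / q ^ 2 = 1})
    (P₁ P₂ P₃ P₁' P₂' P₃' : Pt)
    (h1 : ‖P₁‖ = R) (h2 : ‖P₂‖ = R) (h3 : ‖P₃‖ = R)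
    (h1' : ‖P₁'‖ = R) (h2' : ‖P₂'‖ = R) (h3' : ‖P₃'‖ = R)
    (hncol : ¬ Collinear ℝ ({P₁, P₂, P₃} : Set Pt))
    (hncol' : ¬ Collinear ℝ ({P₁', P₂', P₃'} : Set Pt))
    (ht12 : IsTangentTo (lineThrough P₁ P₂) C)
    (ht23 : IsTangentTo (lineThrough P₂ P₃) C)
    (ht31 : IsTangentTo (lineThrough P₃ P₁) C)
    (ht12' : IsTangentTo (lineThrough P₁' P₂') C)
    (ht23' : IsTangentTo (lineThrough P₂' P₃') C)
    (ht31' : IsTangentTo (lineThrough P₃' P₁') C) :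
    ‖P₁ - P₂‖ ^ 2 + ‖P₂ - P₃‖ ^ 2 + ‖P₃ - P₁‖ ^ 2 =
      ‖P₁' - P₂'‖ ^ 2 + ‖P₂' - P₃'‖ ^ 2 + ‖P₃' - P₁'‖ ^ 2 := by
  subst hC
  rw [sum_sq_sides_eq hq hqp hpR h1 h2 h3 hncol ht12 ht23 ht31,
    sum_sq_sides_eq hq hqp hpR h1' h2' h3' hncol' ht12' ht23' ht31']
end
end

section
/- Let R > 0 and 0 < q ≤ p < R, and let C be the concentric ellipse {(x,y) ∈ ℝ² : x²/p² + y²/q² = 1}. Let P₁, P₂, P₃ and P₁′, P₂′, P₃′ each be triples of non-collinear points on the circle of radius R centered at the origin of ℝ², such that for each triple all three side lines are tangent to C. Let θ₁, θ₂, θ₃ and θ₁′, θ₂′, θ₃′ be the respective interior angles of the two triangles. Then π·R²·(cos²θ₁ + cos²θ₂ + cos²θ₃) = π·R²·(cos²θ₁′ + cos²θ₂′ + cos²θ₃′); that is, the sum of the areas of the three Frégier circles (the circle of radius R·|cos θᵢ| associated with vertex Pᵢ and angle θᵢ) is the same for every 3-orbit of the Poncelet circle–ellipse family. -/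
open EuclideanGeometry

noncomputable section

/-- If a line meets an ellipse in exactly one point, the discriminant vanishes. -/
lemma discrim_of_isTangentTo {p q : ℝ} (hp : 0 < p) (hq : 0 < q) {P Q : Pt} (hPQ : P ≠ Q)
    (ht : IsTangentTo (lineThrough P Q) {x : Pt | x 0 ^ 2 / p ^ 2 + x 1 ^ 2 / q ^ 2 = 1}) :
    p ^ 2 * (Q 1 - P 1) ^ 2 + q ^ 2 * (Q 0 - P 0) ^ 2 = (P 0 * Q 1 - P 1 * Q 0) ^ 2 := by
  obtain ⟨X, ⟨hXl, hXC⟩, huniq⟩ := ht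
  obtain ⟨t, rfl⟩ := mem_affineSpan_pair_iff_exists_lineMap_eq.1 hXl
  have hd : 0 < q ^ 2 * (Q 0 - P 0) ^ 2 + p ^ 2 * (Q 1 - P 1) ^ 2 := by
    by_contra! h
    have h0 : 0 ≤ q ^ 2 * (Q 0 - P 0) ^ 2 := by positivity
    have h1 : 0 ≤ p ^ 2 * (Q 1 - P 1) ^ 2 := by positivity
    have h0' : q ^ 2 * (Q 0 - P 0) ^ 2 = 0 := by linarith
    have h1' : p ^ 2 * (Q 1 - P 1) ^ 2 = 0 := by linarith
    apply hPQ
    ext i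
    fin_cases i
    · have := (mul_eq_zero.1 h0').resolve_left (by positivity)
      simpa using (sub_eq_zero.1 (pow_eq_zero_iff two_ne_zero |>.1 this)).symm
    · have := (mul_eq_zero.1 h1').resolve_left (by positivity)
      simpa using (sub_eq_zero.1 (pow_eq_zero_iff two_ne_zero |>.1 this)).symm
  have mem_iff (s : ℝ) : AffineMap.lineMap P Q s ∈
      {x : Pt | x 0 ^ 2 / p ^ 2 + x 1 ^ 2 / q ^ 2 = 1} ↔
      q ^ 2 * (P 0 + s * (Q 0 - P 0)) ^ 2 + p ^ 2 * (P 1 + s * (Q 1 - P 1)) ^ 2 =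
        p ^ 2 * q ^ 2 := by
    simp only [Set.mem_ofPred_eq, AffineMap.lineMap_apply, vsub_eq_sub, vadd_eq_add,
      PiLp.add_apply, PiLp.smul_apply, PiLp.sub_apply, smul_eq_mul]
    rw [div_add_div _ _ (by positivity) (by positivity), div_eq_one_iff_eq (by positivity)]
    constructor <;> intro h <;> linear_combination h
  rw [mem_iff] at hXC
  set a := q ^ 2 * (Q 0 - P 0) ^ 2 + p ^ 2 * (Q 1 - P 1) ^ 2 with ha
  set b := q ^ 2 * P 0 * (Q 0 - P 0) + p ^ 2 * P 1 * (Q 1 - P 1) with hb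
  have hroot : a * (-2 * b / a - t) = -2 * b - a * t := by field_simp
  have heq := huniq (AffineMap.lineMap P Q (-2 * b / a - t))
    ⟨AffineMap.lineMap_mem_affineSpan_pair _ _ _, (mem_iff _).2 (by
      generalize -2 * b / a - t = s at hroot
      linear_combination hXC + (s - t) * hroot)⟩
  have hs := AffineMap.lineMap_injective ℝ hPQ heq
  rw [hs] at hroot
  have hat : a * t = -b := by linarith
  have key : b ^ 2 = a * (q ^ 2 * P 0 ^ 2 + p ^ 2 * P 1 ^ 2 - p ^ 2 * q ^ 2) := by
    linear_combination (-a) * hXC + (a * t + b) * hat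
  have hpq : p ^ 2 * q ^ 2 ≠ 0 := by positivity
  apply mul_left_cancel₀ hpq
  linear_combination key

lemma norm_sq_eq_coords (P : Pt) : ‖P‖ ^ 2 = P 0 ^ 2 + P 1 ^ 2 := by
  simp [EuclideanSpace.norm_sq_eq]

/-- Tangency to the ellipse of a chord of the circle of radius `R`, as a bilinear relation
between the endpoints of the chord. -/
lemma chord_relation {p q R : ℝ} (hp : 0 < p) (hq : 0 < q) {P Q : Pt} (hPQ : P ≠ Q)
    (hP : ‖P‖ = R) (hQ : ‖Q‖ = R)
    (ht : IsTangentTo (lineThrough P Q) {x : Pt | x 0 ^ 2 / p ^ 2 + x 1 ^ 2 / q ^ 2 = 1}) :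
    (p ^ 2 + q ^ 2 - R ^ 2) * R ^ 2 + (p ^ 2 - q ^ 2) * (P 0 * Q 0 - P 1 * Q 1) =
      R ^ 2 * (P 0 * Q 0 + P 1 * Q 1) := by
  have hd := discrim_of_isTangentTo hp hq hPQ ht
  have hP2 := norm_sq_eq_coords P
  have hQ2 := norm_sq_eq_coords Q
  rw [hP] at hP2
  rw [hQ] at hQ2
  have hne : R ^ 2 - (P 0 * Q 0 + P 1 * Q 1) ≠ 0 := by
    have hsub : ‖P - Q‖ ^ 2 ≠ 0 := pow_ne_zero _ (norm_ne_zero_iff.2 (sub_ne_zero.2 hPQ))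
    rw [norm_sq_eq_coords] at hsub
    contrapose! hsub
    simp only [PiLp.sub_apply]
    linear_combination 2 * hsub - hP2 - hQ2
  have hdiff : R ^ 2 * ((Q 0 - P 0) ^ 2 - (Q 1 - P 1) ^ 2) =
      -2 * (P 0 * Q 0 - P 1 * Q 1) * (R ^ 2 - (P 0 * Q 0 + P 1 * Q 1)) := by
    linear_combination (Q 0 ^ 2 - Q 1 ^ 2) * hP2 + (P 0 ^ 2 - P 1 ^ 2) * hQ2
  have hcross : (P 0 * Q 1 - P 1 * Q 0) ^ 2 = R ^ 4 - (P 0 * Q 0 + P 1 * Q 1) ^ 2 := by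
    linear_combination (-Q 0 ^ 2 - Q 1 ^ 2) * hP2 - R ^ 2 * hQ2
  apply mul_left_cancel₀ hne
  linear_combination R ^ 2 * hd + R ^ 2 * hcross + (p ^ 2 - q ^ 2) / 2 * hdiff +
    (p ^ 2 + q ^ 2) / 2 * R ^ 2 * (hP2 + hQ2)

/-- The squared cosine of an inscribed angle in terms of the endpoints of its chord. -/
lemma cos_angle_sq_of_norm_eq {R : ℝ} (hR : 0 < R) {P₁ P₂ P₃ : Pt}
    (h1 : ‖P₁‖ = R) (h2 : ‖P₂‖ = R) (h3 : ‖P₃‖ = R) (h12 : P₁ ≠ P₂) (h23 : P₂ ≠ P₃) :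
    Real.cos (EuclideanGeometry.angle P₁ P₂ P₃) ^ 2 = ‖P₁ + P₃‖ ^ 2 / (4 * R ^ 2) := by
  have e1 := norm_sq_eq_coords P₁
  have e2 := norm_sq_eq_coords P₂
  have e3 := norm_sq_eq_coords P₃
  rw [h1] at e1
  rw [h2] at e2
  rw [h3] at e3
  have n1 : ‖P₁ - P₂‖ ≠ 0 := norm_ne_zero_iff.2 (sub_ne_zero.2 h12)
  have n3 : ‖P₃ - P₂‖ ≠ 0 := norm_ne_zero_iff.2 (sub_ne_zero.2 h23.symm)
  have s1 : ‖P₁ - P₂‖ ^ 2 = 2 * (R ^ 2 - (P₁ 0 * P₂ 0 + P₁ 1 * P₂ 1)) := by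
    rw [norm_sq_eq_coords]
    simp only [PiLp.sub_apply]
    linear_combination - e1 - e2
  have s3 : ‖P₃ - P₂‖ ^ 2 = 2 * (R ^ 2 - (P₂ 0 * P₃ 0 + P₂ 1 * P₃ 1)) := by
    rw [norm_sq_eq_coords]
    simp only [PiLp.sub_apply]
    linear_combination - e3 - e2
  have s13 : ‖P₁ + P₃‖ ^ 2 = 2 * (R ^ 2 + (P₁ 0 * P₃ 0 + P₁ 1 * P₃ 1)) := by
    rw [norm_sq_eq_coords]
    simp only [PiLp.add_apply]
    linear_combination - e1 - e3
  have hin : inner ℝ (P₁ - P₂) (P₃ - P₂) = R ^ 2 + (P₁ 0 * P₃ 0 + P₁ 1 * P₃ 1) -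
      (P₁ 0 * P₂ 0 + P₁ 1 * P₂ 1) - (P₂ 0 * P₃ 0 + P₂ 1 * P₃ 1) := by
    simp only [PiLp.inner_apply, Fin.sum_univ_two, PiLp.sub_apply, RCLike.inner_apply, conj_trivial]
    linear_combination - e2
  have gram : R ^ 2 * R ^ 2 * R ^ 2 + 2 * (P₁ 0 * P₂ 0 + P₁ 1 * P₂ 1) *
        (P₂ 0 * P₃ 0 + P₂ 1 * P₃ 1) * (P₁ 0 * P₃ 0 + P₁ 1 * P₃ 1) =
      R ^ 2 * (P₁ 0 * P₂ 0 + P₁ 1 * P₂ 1) ^ 2 + R ^ 2 * (P₂ 0 * P₃ 0 + P₂ 1 * P₃ 1) ^ 2 +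
        R ^ 2 * (P₁ 0 * P₃ 0 + P₁ 1 * P₃ 1) ^ 2 := by
    nth_rw 1 [e1]
    nth_rw 1 [e2]
    nth_rw 1 [e3]
    nth_rw 1 [e3]
    nth_rw 1 [e1]
    rw [e2]
    ring
  rw [EuclideanGeometry.angle, vsub_eq_sub, vsub_eq_sub, InnerProductGeometry.cos_angle,
    div_pow, mul_pow, div_eq_div_iff (by positivity) (by positivity), hin, s1, s3, s13]
  linear_combination (-4) * gram

/-- Three distinct points on the circle of radius `R` whose pairs satisfy the same bilinear
relation have a vertex sum of prescribed length. When `L = 0` both sides vanish. -/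
lemma norm_sq_sum_of_relations {K L R : ℝ} (hR : 0 < R) {P₁ P₂ P₃ : Pt}
    (h1 : ‖P₁‖ = R) (h2 : ‖P₂‖ = R) (h3 : ‖P₃‖ = R)
    (h12 : P₁ ≠ P₂) (h23 : P₂ ≠ P₃) (h31 : P₃ ≠ P₁)
    (r12 : K * R ^ 2 + L * (P₁ 0 * P₂ 0 - P₁ 1 * P₂ 1) = R ^ 2 * (P₁ 0 * P₂ 0 + P₁ 1 * P₂ 1))
    (r23 : K * R ^ 2 + L * (P₂ 0 * P₃ 0 - P₂ 1 * P₃ 1) = R ^ 2 * (P₂ 0 * P₃ 0 + P₂ 1 * P₃ 1))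
    (r31 : K * R ^ 2 + L * (P₃ 0 * P₁ 0 - P₃ 1 * P₁ 1) = R ^ 2 * (P₃ 0 * P₁ 0 + P₃ 1 * P₁ 1)) :
    ‖P₁ + P₂ + P₃‖ ^ 2 = ((2 * K + R ^ 2) * R / L) ^ 2 := by
  let z (P : Pt) : ℂ := ⟨P 0, P 1⟩
  have norm_z (P : Pt) : ‖z P‖ = ‖P‖ := by
    rw [← sq_eq_sq₀ (norm_nonneg _) (norm_nonneg _), norm_sq_eq_coords, Complex.sq_norm,
      Complex.normSq_apply]
    ring
  have z_add (P Q : Pt) : z (P + Q) = z P + z Q := by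
    apply Complex.ext <;> simp [z]
  have z_ne {P Q : Pt} (h : P ≠ Q) : z P - z Q ≠ 0 := by
    contrapose! h
    have h0 := congrArg Complex.re h
    have h1 := congrArg Complex.im h
    simp only [z, Complex.sub_re, Complex.sub_im, Complex.zero_re, Complex.zero_im] at h0 h1
    ext i
    fin_cases i
    · exact sub_eq_zero.1 h0
    · exact sub_eq_zero.1 h1
  have z_conj {P : Pt} (h : ‖P‖ = R) : z P * (starRingEnd ℂ) (z P) = (R : ℂ) ^ 2 := by
    rw [Complex.mul_conj, Complex.normSq_eq_norm_sq, norm_z, h]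
    push_cast
    rfl
  have rel {P Q : Pt} (hP : ‖P‖ = R) (hQ : ‖Q‖ = R)
      (r : K * R ^ 2 + L * (P 0 * Q 0 - P 1 * Q 1) = R ^ 2 * (P 0 * Q 0 + P 1 * Q 1)) :
      2 * (K : ℂ) * R ^ 2 * (z P * z Q) + L * (z P ^ 2 * z Q ^ 2 + R ^ 4) =
        R ^ 4 * (z P ^ 2 + z Q ^ 2) := by
    have hr : 2 * (K : ℂ) * R ^ 2 + L * (z P * z Q + (starRingEnd ℂ) (z P) * (starRingEnd ℂ) (z Q))
        = R ^ 2 * (z P * (starRingEnd ℂ) (z Q) + (starRingEnd ℂ) (z P) * z Q) := by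
      apply Complex.ext
      · simp [z, pow_two]
        linear_combination 2 * r
      · simp [z, pow_two]
        ring
    linear_combination z P * z Q * hr
      - (L * z Q * (starRingEnd ℂ) (z Q) - R ^ 2 * z Q ^ 2) * z_conj hP
      - (L * R ^ 2 - R ^ 2 * z P ^ 2) * z_conj hQ
  have c12 := rel h1 h2 r12
  have c23 := rel h2 h3 r23
  have c31 := rel h3 h1 r31
  have d12 := z_ne h12
  have d23 := z_ne h23
  have d31 := z_ne h31
  have w1 := z_conj h1
  have w2 := z_conj h2
  have w3 := z_conj h3
  have hsum : z (P₁ + P₂ + P₃) = z P₁ + z P₂ + z P₃ := by rw [z_add, z_add]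
  have n1 : ‖z P₁‖ = R := (norm_z _).trans h1
  have n2 : ‖z P₂‖ = R := (norm_z _).trans h2
  have n3 : ‖z P₃‖ = R := (norm_z _).trans h3
  rw [← norm_z, hsum]
  generalize z P₁ = a at *
  generalize z P₂ = b at *
  generalize z P₃ = c at *
  have ha : 2 * (K : ℂ) * R ^ 2 * a + L * a ^ 2 * (b + c) = R ^ 4 * (b + c) := by
    apply mul_left_cancel₀ d23
    linear_combination c12 - c31
  have hb : 2 * (K : ℂ) * R ^ 2 * b + L * b ^ 2 * (a + c) = R ^ 4 * (a + c) := by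
    have : a - c ≠ 0 := sub_ne_zero.2 (sub_ne_zero.1 d31).symm
    apply mul_left_cancel₀ this
    linear_combination c12 - c23
  have hm : (L : ℂ) * (a * b + b * c + c * a) = -((2 * K + R ^ 2) * R ^ 2) := by
    apply mul_left_cancel₀ d12
    linear_combination ha - hb
  have hconj : a * b * c * (starRingEnd ℂ) (a + b + c) = R ^ 2 * (a * b + b * c + c * a) := by
    simp only [map_add]
    linear_combination b * c * w1 + a * c * w2 + a * b * w3
  have hnorm : R * ‖a + b + c‖ = ‖a * b + b * c + c * a‖ := by
    have := congrArg norm hconj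
    simp only [norm_mul, norm_pow, n1, n2, n3, RCLike.norm_conj, Complex.norm_real,
      Real.norm_eq_abs, abs_of_pos hR] at this
    apply mul_left_cancel₀ (pow_ne_zero 2 hR.ne')
    linear_combination this
  have hRc : (R : ℂ) ≠ 0 := by exact_mod_cast hR.ne'
  rcases eq_or_ne L 0 with rfl | hL
  · have hm0 : (2 * (K : ℂ) + R ^ 2) * R ^ 2 = 0 := by
      linear_combination (norm := (push_cast; ring)) hm
    have hs : a + b + c = 0 := by
      apply mul_left_cancel₀ (pow_ne_zero 4 hRc)
      linear_combination (norm := (push_cast; ring)) -ha + a * hm0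
    simp [hs]
  · have hmn : |L| * (R * ‖a + b + c‖) = |(2 * K + R ^ 2) * R ^ 2| := by
      have := congrArg norm hm
      rw [norm_mul, norm_neg, Complex.norm_real, Real.norm_eq_abs, ← hnorm] at this
      rw [this, ← Real.norm_eq_abs, ← Complex.norm_real]
      push_cast
      rfl
    have hsq := congrArg (· ^ 2) hmn
    simp only [mul_pow, sq_abs] at hsq
    rw [div_pow, eq_div_iff (by positivity)]
    apply mul_left_cancel₀ (pow_ne_zero 2 hR.ne')
    linear_combination hsq

/-- The sum of the squared cosines of the angles of a triangle inscribed in the circle of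
radius `R` and circumscribed about the ellipse with semi-axes `p`, `q`. -/
lemma sum_cos_sq_of_poncelet {R p q : ℝ} (hR : 0 < R) (hp : 0 < p) (hq : 0 < q)
    {P₁ P₂ P₃ : Pt} (h1 : ‖P₁‖ = R) (h2 : ‖P₂‖ = R) (h3 : ‖P₃‖ = R)
    (hncol : ¬ Collinear ℝ ({P₁, P₂, P₃} : Set Pt))
    (ht12 : IsTangentTo (lineThrough P₁ P₂) {x : Pt | x 0 ^ 2 / p ^ 2 + x 1 ^ 2 / q ^ 2 = 1})
    (ht23 : IsTangentTo (lineThrough P₂ P₃) {x : Pt | x 0 ^ 2 / p ^ 2 + x 1 ^ 2 / q ^ 2 = 1})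
    (ht31 : IsTangentTo (lineThrough P₃ P₁) {x : Pt | x 0 ^ 2 / p ^ 2 + x 1 ^ 2 / q ^ 2 = 1}) :
    Real.cos (EuclideanGeometry.angle P₃ P₁ P₂) ^ 2 +
        Real.cos (EuclideanGeometry.angle P₁ P₂ P₃) ^ 2 +
          Real.cos (EuclideanGeometry.angle P₂ P₃ P₁) ^ 2 =
      (3 * R ^ 2 + ((2 * (p ^ 2 + q ^ 2 - R ^ 2) + R ^ 2) * R / (p ^ 2 - q ^ 2)) ^ 2) /
        (4 * R ^ 2) := by
  have h12 := ne₁₂_of_not_collinear hncol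
  have h23 := ne₂₃_of_not_collinear hncol
  have h31 := (ne₁₃_of_not_collinear hncol).symm
  rw [← norm_sq_sum_of_relations hR h1 h2 h3 h12 h23 h31
      (chord_relation hp hq h12 h1 h2 ht12) (chord_relation hp hq h23 h2 h3 ht23)
      (chord_relation hp hq h31 h3 h1 ht31),
    cos_angle_sq_of_norm_eq hR h3 h1 h2 h31 h12, cos_angle_sq_of_norm_eq hR h1 h2 h3 h12 h23,
    cos_angle_sq_of_norm_eq hR h2 h3 h1 h23 h31, ← add_div, ← add_div]
  congr 1
  have e1 := norm_sq_eq_coords P₁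
  have e2 := norm_sq_eq_coords P₂
  have e3 := norm_sq_eq_coords P₃
  rw [h1] at e1
  rw [h2] at e2
  rw [h3] at e3
  simp only [norm_sq_eq_coords, PiLp.add_apply]
  linear_combination - e1 - e2 - e3

/-- **Poncelet invariant: sum of Frégier circle areas.** For any two triangles of the
Poncelet family inscribed in the circle of radius `R` and circumscribing the concentric
ellipse `x²/p² + y²/q² = 1`, the sums `π R² ∑ cos²θᵢ` of the areas of the three Frégier
circles agree. -/
theorem poncelet_fregier_areas_invariant (R p q : ℝ) (hq : 0 < q) (hqp : q ≤ p)
    (hpR : p < R)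
    (C : Set Pt) (hC : C = {x : Pt | x 0 ^ 2 / p ^ 2 + x 1 ^ 2 / q ^ 2 = 1})
    (P₁ P₂ P₃ P₁' P₂' P₃' : Pt)
    (h1 : ‖P₁‖ = R) (h2 : ‖P₂‖ = R) (h3 : ‖P₃‖ = R)
    (h1' : ‖P₁'‖ = R) (h2' : ‖P₂'‖ = R) (h3' : ‖P₃'‖ = R)
    (hncol : ¬ Collinear ℝ ({P₁, P₂, P₃} : Set Pt))
    (hncol' : ¬ Collinear ℝ ({P₁', P₂', P₃'} : Set Pt))
    (ht12 : IsTangentTo (lineThrough P₁ P₂) C)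
    (ht23 : IsTangentTo (lineThrough P₂ P₃) C)
    (ht31 : IsTangentTo (lineThrough P₃ P₁) C)
    (ht12' : IsTangentTo (lineThrough P₁' P₂') C)
    (ht23' : IsTangentTo (lineThrough P₂' P₃') C)
    (ht31' : IsTangentTo (lineThrough P₃' P₁') C) :
    Real.pi * R ^ 2 *
        (Real.cos (EuclideanGeometry.angle P₃ P₁ P₂) ^ 2 +
          Real.cos (EuclideanGeometry.angle P₁ P₂ P₃) ^ 2 +
            Real.cos (EuclideanGeometry.angle P₂ P₃ P₁) ^ 2) =
      Real.pi * R ^ 2 *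
        (Real.cos (EuclideanGeometry.angle P₃' P₁' P₂') ^ 2 +
          Real.cos (EuclideanGeometry.angle P₁' P₂' P₃') ^ 2 +
            Real.cos (EuclideanGeometry.angle P₂' P₃' P₁') ^ 2) := by
  subst hC
  have hp := hq.trans_le hqp
  have hR := hp.trans hpR
  rw [sum_cos_sq_of_poncelet hR hp hq h1 h2 h3 hncol ht12 ht23 ht31,
    sum_cos_sq_of_poncelet hR hp hq h1' h2' h3' hncol' ht12' ht23' ht31']
end
end

section
/- Let R > 0 and 0 < q ≤ p < R, and let C be the concentric ellipse {(x,y) ∈ ℝ² : x²/p² + y²/q² = 1}. Let P₁, P₂, P₃ be non-collinear points on the circle of radius R centered at the origin of ℝ² such that all three side lines of the triangle P₁P₂P₃ are tangent to C, and let θ₁, θ₂, θ₃ be the interior angles of the triangle. Setting rᵢ = R·|cos θᵢ| (the radius of the Frégier circle at Pᵢ), one has 3/4 ≤ (r₁² + r₂² + r₃²)/R² ≤ 1, i.e. 3/4 ≤ cos²θ₁ + cos²θ₂ + cos²θ₃ ≤ 1. -/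
open EuclideanGeometry

noncomputable section

lemma sub_ne_zero_or_of_ne {A B : Pt} (hAB : A ≠ B) : B 0 - A 0 ≠ 0 ∨ B 1 - A 1 ≠ 0 := by
  by_contra! hv
  refine hAB (PiLp.ext fun i => ?_)
  fin_cases i
  · simpa using (sub_eq_zero.1 hv.1).symm
  · simpa using (sub_eq_zero.1 hv.2).symm

/-- The tangency point of a line `AB` to an ellipse, in coordinates: it is a point of the line
whose position vector is conjugate to the direction of the line. -/
lemma exists_tangency_point {p q : ℝ} (hp : 0 < p) (hq : 0 < q) {A B : Pt} (hAB : A ≠ B)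
    (h : IsTangentTo (lineThrough A B) {x : Pt | x 0 ^ 2 / p ^ 2 + x 1 ^ 2 / q ^ 2 = 1}) :
    ∃ t x y : ℝ, x = A 0 + t * (B 0 - A 0) ∧ y = A 1 + t * (B 1 - A 1) ∧
      x ^ 2 / p ^ 2 + y ^ 2 / q ^ 2 = 1 ∧
      x / p ^ 2 * (B 0 - A 0) + y / q ^ 2 * (B 1 - A 1) = 0 := by
  obtain ⟨T, ⟨hT, hTC⟩, huniq⟩ := h
  obtain ⟨t, rfl⟩ := mem_affineSpan_pair_iff_exists_lineMap_eq.1 hT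
  have coord (r : ℝ) (i : Fin 2) :
      (AffineMap.lineMap A B r : Pt) i = A i + r * (B i - A i) := by
    simp [AffineMap.lineMap_apply]; ring
  simp only [Set.mem_ofPred_eq, coord] at hTC
  refine ⟨t, _, _, rfl, rfl, hTC, ?_⟩
  have hne : B 0 - A 0 ≠ 0 ∨ B 1 - A 1 ≠ 0 := sub_ne_zero_or_of_ne hAB
  set u := B 0 - A 0
  set v := B 1 - A 1
  set x := A 0 + t * u with hx
  set y := A 1 + t * v with hy
  have ha : 0 < u ^ 2 / p ^ 2 + v ^ 2 / q ^ 2 := by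
    rcases hne with h0 | h0 <;> positivity
  set a := u ^ 2 / p ^ 2 + v ^ 2 / q ^ 2 with ha'
  set b := x / p ^ 2 * u + y / q ^ 2 * v with hb
  have hmem : (AffineMap.lineMap A B (t - 2 * b / a) : Pt) ∈
      lineThrough A B ∩ {x : Pt | x 0 ^ 2 / p ^ 2 + x 1 ^ 2 / q ^ 2 = 1} := by
    refine ⟨AffineMap.lineMap_mem_affineSpan_pair _ _ _, ?_⟩
    simp only [Set.mem_ofPred_eq, coord]
    have expand (s : ℝ) : (A 0 + (t - s) * u) ^ 2 / p ^ 2 + (A 1 + (t - s) * v) ^ 2 / q ^ 2 =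
        (x ^ 2 / p ^ 2 + y ^ 2 / q ^ 2) - 2 * s * b + s ^ 2 * a := by
      simp only [hx, hy, ha', hb]; ring
    change (A 0 + (t - 2 * b / a) * u) ^ 2 / p ^ 2 + (A 1 + (t - 2 * b / a) * v) ^ 2 / q ^ 2 = 1
    rw [expand, hTC]
    field_simp
    ring
  have heq := huniq _ hmem
  have hinj := AffineMap.lineMap_injective ℝ hAB heq
  have : 2 * b / a = 0 := by linarith
  rcases div_eq_zero_iff.1 this with h0 | h0
  · linarith
  · exact absurd h0 ha.ne'

/-- The ellipse lies on one side of each of its tangent lines: if `m` is normal to the tangent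
line through `(x, y)` with direction `(u, v)`, and `m` is nonnegative at the tangency point, then
`m` is maximal there. -/
lemma ellipse_le_of_tangent {p q x y u v m n e f : ℝ} (huv : u ≠ 0 ∨ v ≠ 0)
    (hxy : x ^ 2 / p ^ 2 + y ^ 2 / q ^ 2 = 1) (hef : e ^ 2 / p ^ 2 + f ^ 2 / q ^ 2 = 1)
    (hconj : x / p ^ 2 * u + y / q ^ 2 * v = 0) (hmn : m * u + n * v = 0)
    (hk : 0 ≤ m * x + n * y) : m * e + n * f ≤ m * x + n * y := by
  have hcross : m * (y / q ^ 2) = n * (x / p ^ 2) := by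
    rcases huv with h | h
    · exact mul_right_cancel₀ h (by linear_combination (y / q ^ 2) * hmn - n * hconj)
    · exact mul_right_cancel₀ h (by linear_combination m * hconj - (x / p ^ 2) * hmn)
  have hm : m = (m * x + n * y) * (x / p ^ 2) := by
    linear_combination (-m) * hxy + y * hcross
  have hn : n = (m * x + n * y) * (y / q ^ 2) := by
    linear_combination (-n) * hxy - x * hcross
  have hle : x / p ^ 2 * e + y / q ^ 2 * f ≤ 1 := by
    have h1 : 0 ≤ (x - e) ^ 2 / p ^ 2 + (y - f) ^ 2 / q ^ 2 := by positivity
    have h2 : (x - e) ^ 2 / p ^ 2 + (y - f) ^ 2 / q ^ 2 =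
        (x ^ 2 / p ^ 2 + y ^ 2 / q ^ 2) + (e ^ 2 / p ^ 2 + f ^ 2 / q ^ 2) -
          2 * (x / p ^ 2 * e + y / q ^ 2 * f) := by ring
    linarith
  calc m * e + n * f
      = (m * x + n * y) * (x / p ^ 2 * e + y / q ^ 2 * f) := by
        linear_combination e * hm + f * hn
    _ ≤ (m * x + n * y) * 1 := mul_le_mul_of_nonneg_left hle hk
    _ = _ := mul_one _

lemma sq_add_sq_le_of_ellipse {p q x y : ℝ} (hq : 0 < q) (hqp : q ≤ p)
    (h : x ^ 2 / p ^ 2 + y ^ 2 / q ^ 2 = 1) : x ^ 2 + y ^ 2 ≤ p ^ 2 := by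
  have hp : 0 < p := hq.trans_le hqp
  have h1 : y ^ 2 / p ^ 2 ≤ y ^ 2 / q ^ 2 := by gcongr
  have h2 : (x ^ 2 + y ^ 2) / p ^ 2 ≤ 1 := by rw [add_div]; linarith
  rwa [div_le_one (by positivity)] at h2

lemma sq_add_sq_of_norm_eq {P : Pt} {R : ℝ} (h : ‖P‖ = R) : P 0 ^ 2 + P 1 ^ 2 = R ^ 2 := by
  rw [← h, EuclideanSpace.norm_sq_eq]
  simp [Fin.sum_univ_two]

/-- A triangle inscribed in a circle and circumscribed about a concentric ellipse inside the
circle has no obtuse angle. -/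
lemma cos_angle_nonneg_of_tangent {R p q : ℝ} (hq : 0 < q) (hqp : q ≤ p) (hpR : p < R)
    {A B X : Pt} (hA : ‖A‖ = R) (hB : ‖B‖ = R) (hX : ‖X‖ = R) (hAB : A ≠ B) (hXA : X ≠ A)
    (htAB : IsTangentTo (lineThrough A B) {x : Pt | x 0 ^ 2 / p ^ 2 + x 1 ^ 2 / q ^ 2 = 1})
    (htXA : IsTangentTo (lineThrough X A) {x : Pt | x 0 ^ 2 / p ^ 2 + x 1 ^ 2 / q ^ 2 = 1}) :
    0 ≤ Real.cos (EuclideanGeometry.angle B X A) := by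
  have hp : 0 < p := hq.trans_le hqp
  obtain ⟨t, x, y, hx, hy, hxy, hconj⟩ := exists_tangency_point hp hq hAB htAB
  obtain ⟨s, e, f, he, hf, hef, -⟩ := exists_tangency_point hp hq hXA htXA
  replace hA := sq_add_sq_of_norm_eq hA
  replace hB := sq_add_sq_of_norm_eq hB
  replace hX := sq_add_sq_of_norm_eq hX
  have huv : B 0 - A 0 ≠ 0 ∨ B 1 - A 1 ≠ 0 := sub_ne_zero_or_of_ne hAB
  have hk : (A 0 + B 0) * x + (A 1 + B 1) * y = R ^ 2 + A 0 * B 0 + A 1 * B 1 := by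
    rw [hx, hy]; linear_combination (1 - t) * hA + t * hB
  have hk0 : 0 ≤ R ^ 2 + A 0 * B 0 + A 1 * B 1 := by
    nlinarith [sq_nonneg (A 0 + B 0), sq_nonneg (A 1 + B 1)]
  have hside := ellipse_le_of_tangent (m := A 0 + B 0) (n := A 1 + B 1) huv hxy hef hconj
    (by linear_combination hB - hA) (hk ▸ hk0)
  have hlt : e ^ 2 + f ^ 2 < R ^ 2 :=
    (sq_add_sq_le_of_ellipse hq hqp hef).trans_lt (by gcongr)
  have hs : 0 < s * (1 - s) := by
    have hd : e ^ 2 + f ^ 2 =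
        R ^ 2 - s * (1 - s) * ((A 0 - X 0) ^ 2 + (A 1 - X 1) ^ 2) := by
      rw [he, hf]; linear_combination (1 - s) * hX + s * hA
    exact pos_of_mul_pos_left (b := (A 0 - X 0) ^ 2 + (A 1 - X 1) ^ 2) (by linarith) (by positivity)
  have hs1 : 0 < 1 - s := by
    by_contra! h
    exact hs.not_ge (mul_nonpos_of_nonneg_of_nonpos (by linarith) h)
  have hinner : 0 ≤ (B 0 - X 0) * (A 0 - X 0) + (B 1 - X 1) * (A 1 - X 1) := by
    have : 0 ≤ (1 - s) * ((B 0 - X 0) * (A 0 - X 0) + (B 1 - X 1) * (A 1 - X 1)) := by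
      rw [hk, he, hf] at hside
      linear_combination hside - s * hA - (1 - s) * hX
    exact nonneg_of_mul_nonneg_right this hs1
  rw [EuclideanGeometry.angle, InnerProductGeometry.cos_angle]
  refine div_nonneg ?_ (by positivity)
  simp [PiLp.inner_apply, Fin.sum_univ_two]
  linarith

/-- For a triangle without obtuse angles, `3 / 4 ≤ ∑ cos² ≤ 1`. -/
lemma sum_sq_cos_bounds {a b c : ℝ} (h : a + b + c = Real.pi) (ha : 0 ≤ Real.cos a)
    (hb : 0 ≤ Real.cos b) (hc : 0 ≤ Real.cos c) :
    3 / 4 ≤ Real.cos a ^ 2 + Real.cos b ^ 2 + Real.cos c ^ 2 ∧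
      Real.cos a ^ 2 + Real.cos b ^ 2 + Real.cos c ^ 2 ≤ 1 := by
  have hc' : Real.cos c = Real.sin a * Real.sin b - Real.cos a * Real.cos b := by
    rw [show c = Real.pi - (a + b) by linarith, Real.cos_pi_sub, Real.cos_add]; ring
  have hsum : Real.cos a ^ 2 + Real.cos b ^ 2 + Real.cos c ^ 2 =
      1 - 2 * (Real.cos a * Real.cos b * Real.cos c) := by
    have h1 := Real.sin_sq_add_cos_sq a
    have h2 := Real.sin_sq_add_cos_sq b
    rw [hc']
    linear_combination (Real.sin b ^ 2) * h1 + (1 - Real.cos a ^ 2) * h2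
  have hsum' : Real.cos a ^ 2 + Real.cos b ^ 2 + Real.cos c ^ 2 =
      1 - Real.cos c * Real.cos (a - b) + Real.cos c ^ 2 := by
    have h1 : Real.cos c * Real.cos (a - b) =
        2 * (Real.cos a * Real.cos b * Real.cos c) + Real.cos c ^ 2 := by
      rw [Real.cos_sub]; linear_combination (-Real.cos c) * hc'
    linarith
  constructor
  · nlinarith [sq_nonneg (Real.cos c - 1 / 2), Real.cos_le_one (a - b)]
  · have := mul_nonneg (mul_nonneg ha hb) hc
    linarith

/-- **Bounds on the Frégier-circle radii.** For a triangle inscribed in the circle of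
radius `R` and circumscribing the concentric ellipse `x²/p² + y²/q² = 1`, with interior
angles `θᵢ` and Frégier radii `rᵢ = R·|cos θᵢ|`, one has
`3/4 ≤ (r₁² + r₂² + r₃²)/R² ≤ 1`, i.e. `3/4 ≤ ∑ cos²θᵢ ≤ 1`. -/
theorem fregier_radii_bounds (R p q : ℝ) (hq : 0 < q) (hqp : q ≤ p) (hpR : p < R)
    (C : Set Pt) (hC : C = {x : Pt | x 0 ^ 2 / p ^ 2 + x 1 ^ 2 / q ^ 2 = 1})
    (P₁ P₂ P₃ : Pt)
    (h1 : ‖P₁‖ = R) (h2 : ‖P₂‖ = R) (h3 : ‖P₃‖ = R)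
    (hncol : ¬ Collinear ℝ ({P₁, P₂, P₃} : Set Pt))
    (ht12 : IsTangentTo (lineThrough P₁ P₂) C)
    (ht23 : IsTangentTo (lineThrough P₂ P₃) C)
    (ht31 : IsTangentTo (lineThrough P₃ P₁) C)
    (r₁ r₂ r₃ : ℝ)
    (hr₁ : r₁ = R * |Real.cos (EuclideanGeometry.angle P₃ P₁ P₂)|)
    (hr₂ : r₂ = R * |Real.cos (EuclideanGeometry.angle P₁ P₂ P₃)|)
    (hr₃ : r₃ = R * |Real.cos (EuclideanGeometry.angle P₂ P₃ P₁)|) :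
    3 / 4 ≤ (r₁ ^ 2 + r₂ ^ 2 + r₃ ^ 2) / R ^ 2 ∧
      (r₁ ^ 2 + r₂ ^ 2 + r₃ ^ 2) / R ^ 2 ≤ 1 := by
  have hR : 0 < R := (hq.trans_le hqp).trans hpR
  subst hC
  have h12 : P₁ ≠ P₂ := ne₁₂_of_not_collinear hncol
  have h31 : P₃ ≠ P₁ := (ne₁₃_of_not_collinear hncol).symm
  have h23 : P₂ ≠ P₃ := ne₂₃_of_not_collinear hncol
  have c1 := cos_angle_nonneg_of_tangent hq hqp hpR h2 h3 h1 h23 h12 ht23 ht12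
  have c2 := cos_angle_nonneg_of_tangent hq hqp hpR h3 h1 h2 h31 h23 ht31 ht23
  have c3 := cos_angle_nonneg_of_tangent hq hqp hpR h1 h2 h3 h12 h31 ht12 ht31
  have hπ := EuclideanGeometry.angle_add_angle_add_angle_eq_pi P₃ h12.symm
  have key : (r₁ ^ 2 + r₂ ^ 2 + r₃ ^ 2) / R ^ 2 =
      Real.cos (EuclideanGeometry.angle P₃ P₁ P₂) ^ 2 +
      Real.cos (EuclideanGeometry.angle P₁ P₂ P₃) ^ 2 +
      Real.cos (EuclideanGeometry.angle P₂ P₃ P₁) ^ 2 := by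
    rw [hr₁, hr₂, hr₃]
    simp only [mul_pow, sq_abs]
    field_simp
  rw [key]
  exact sum_sq_cos_bounds (by linarith) c1 c2 c3
end
end
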